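/- arXiv:2009.12761 — 3 statements merged into one kernel-verified Lean document; each statement's English description precedes it below -/
import Mathlib

section
/- Let K = ℚ(ζ₉) and 𝔩 = (1 − ζ₉)·𝒪_K. The 18 roots of unity of K, namely ε·ζ₉^m for ε ∈ {1, −1} and 0 ≤ m ≤ 8, are pairwise incongruent modulo 𝔩⁴; equivalently, the map sending (ε, m) to the class of ε·ζ₉^m in (𝒪_K/𝔩⁴)^× is injective. -/
open NumberField

theorem aux_same {R : Type*} [CommRing R] [IsDomain R] (z : R) (h : z ^ 6 + z ^ 3 + 1 = 0)
    (hx0 : 1 - z ≠ 0) (hu : ¬ IsUnit (1 - z)) (a b : ℕ) (hab : a < b) (hb : b < 9)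
    (hd : (1 - z) ^ 4 ∣ z ^ a - z ^ b) : False := by
  have h9 : z ^ 9 = 1 := by linear_combination (z ^ 3 - 1) * h
  have key : ∀ n, (1 - z) ^ (n + 1) ∣ (1 - z) ^ n → False := by
    rintro n ⟨c, hc⟩
    apply hu
    refine IsUnit.of_mul_eq_one c ?_
    apply mul_left_cancel₀ (pow_ne_zero n hx0)
    rw [mul_one]
    conv_rhs => rw [hc]
    ring
  obtain ⟨k, rfl⟩ : ∃ k, b = a + k := ⟨b - a, by omega⟩
  have hk : (1 - z) ^ 4 ∣ 1 - z ^ k := by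
    have : 1 - z ^ k = (z ^ a - z ^ (a + k)) * z ^ (9 - a) := by
      have e : z ^ a * z ^ (9 - a) = 1 := by rw [← pow_add, ← h9]; congr 1; omega
      rw [pow_add]; linear_combination (z ^ k - 1) * e
    rw [this]; exact hd.mul_right _
  have mulk : ∀ j, (1 - z) ^ 4 ∣ 1 - z ^ (k * j) := fun j => by
    rw [pow_mul]; exact hk.trans (one_sub_dvd_one_sub_pow _ _)
  have red : ∀ q r, z ^ (9 * q + r) = z ^ r := fun q r => by rw [pow_add, pow_mul, h9]; simp
  have mulr : ∀ j q r, k * j = 9 * q + r → (1 - z) ^ 4 ∣ 1 - z ^ r := fun j q r e => by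
    have := mulk j
    rwa [e, red] at this
  have c1 : ¬ (1 - z) ^ 4 ∣ 1 - z := fun h1 =>
    key 1 ((pow_dvd_pow (1 - z) (show 1 + 1 ≤ 4 by norm_num)).trans (by simpa using h1))
  have c3 : ¬ (1 - z) ^ 4 ∣ 1 - z ^ 3 := fun h3 => by
    apply key 3
    have e3 : (1 - z) ^ 4 ∣ 3 := by
      have : (3 : R) = (1 - z ^ 3) * ((1 - z ^ 3) * (- z ^ 6)) := by
        linear_combination (3 - 3 * z ^ 3 + z ^ 6) * h
      rw [this]; exact h3.mul_right _
    have : (1 - z) ^ 3 = (1 - z ^ 3) - 3 * (z * (1 - z)) := by ring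
    rw [this]
    exact dvd_sub h3 (e3.mul_right _)
  have h1 : 1 ≤ k := by omega
  have h8 : k ≤ 8 := by omega
  interval_cases k
  · exact c1 (by simpa using mulk 1)
  · exact c1 (by simpa using mulr 5 1 1 rfl)
  · exact c3 (by simpa using mulk 1)
  · exact c1 (by simpa using mulr 7 3 1 rfl)
  · exact c1 (by simpa using mulr 2 1 1 rfl)
  · exact c3 (by simpa using mulr 2 1 3 rfl)
  · exact c1 (by simpa using mulr 4 3 1 rfl)
  · exact c1 (by simpa using mulr 8 7 1 rfl)

theorem aux_opp {R : Type*} [CommRing R] (z : R) (h : z ^ 6 + z ^ 3 + 1 = 0)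
    (hu : ¬ IsUnit (1 - z)) (a b : ℕ)
    (hd : (1 - z) ^ 4 ∣ z ^ a + z ^ b) : False := by
  apply hu
  have hd1 : 1 - z ∣ z ^ a + z ^ b := (dvd_pow_self _ (by norm_num)).trans hd
  have p : ∀ n, 1 - z ∣ 1 - z ^ n := one_sub_dvd_one_sub_pow z
  have h1 := dvd_sub (dvd_add (p 6) (p 3)) (dvd_add hd1 (dvd_add (p a) (p b)))
  apply isUnit_of_dvd_one
  have : (1 : R) = 1 - z ^ 6 + (1 - z ^ 3) - (z ^ a + z ^ b + (1 - z ^ a + (1 - z ^ b))) := by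
    linear_combination h
  exact h1.trans (dvd_of_eq this.symm)

/-- For `K = ℚ(ζ₉)` and `𝔩 = (1 - ζ₉) 𝓞 K` the prime above 3, the 18 roots of unity
`ε • ζ₉ ^ m` of `K` (with `ε ∈ {1, -1}` and `0 ≤ m ≤ 8`) are pairwise incongruent
modulo `𝔩⁴`. -/
theorem stmt_2 (K : Type*) [Field K] [NumberField K] [IsCyclotomicExtension {9} ℚ K]
    (ζ : K) (hζ : IsPrimitiveRoot ζ 9)
    (z x : 𝓞 K) (hz : (z : K) = ζ) (hx : (x : K) = 1 - ζ)
    (ε₁ ε₂ : 𝓞 K) (hε₁ : ε₁ = 1 ∨ ε₁ = -1) (hε₂ : ε₂ = 1 ∨ ε₂ = -1)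
    (m₁ m₂ : Fin 9)
    (h : ε₁ * z ^ (m₁ : ℕ) - ε₂ * z ^ (m₂ : ℕ) ∈ Ideal.span {x} ^ 4) :
    ε₁ = ε₂ ∧ m₁ = m₂ := by
  have hxz : x = 1 - z := by
    apply RingOfIntegers.ext; rw [hx, ← hz]; simp
  subst hxz
  rw [Ideal.span_singleton_pow, Ideal.mem_span_singleton] at h
  have hz9 : z ^ 9 = 1 := by
    apply RingOfIntegers.ext; simp [hz, hζ.pow_eq_one]
  have hz3 : z ^ 3 - 1 ≠ 0 := by
    intro h0
    have : ζ ^ 3 = 1 := by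
      rw [← hz, ← map_pow, sub_eq_zero.1 h0, map_one]
    exact hζ.pow_ne_one_of_pos_of_lt (by norm_num) (by norm_num) this
  have hΦ : z ^ 6 + z ^ 3 + 1 = 0 := by
    apply mul_left_cancel₀ hz3
    linear_combination hz9
  have hne : (1 - z) ≠ 0 := fun h0 => hz3 (by linear_combination (-z ^ 2 - z - 1) * h0)
  have hu : ¬ IsUnit (1 - z) := by
    have : Fact (Nat.Prime 3) := ⟨by norm_num⟩
    have : IsCyclotomicExtension {3 ^ (1 + 1)} ℚ K := by norm_num; infer_instance
    have hζ' : IsPrimitiveRoot ζ (3 ^ (1 + 1)) := by norm_num; exact hζ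
    have hp := hζ'.zeta_sub_one_prime
    have e : hζ'.toInteger = z := by
      apply RingOfIntegers.ext; rw [hz]; rfl
    rw [e] at hp
    intro hh
    apply hp.not_isUnit
    rw [← neg_sub]; exact hh.neg
  have same : (1 - z) ^ 4 ∣ z ^ (m₁ : ℕ) - z ^ (m₂ : ℕ) → m₁ = m₂ := fun hd => by
    rcases lt_trichotomy (m₁ : ℕ) m₂ with hl | hl | hl
    · exact (aux_same z hΦ hne hu _ _ hl m₂.2 hd).elim
    · exact Fin.ext hl
    · exact (aux_same z hΦ hne hu _ _ hl m₁.2 ((dvd_sub_comm).1 hd)).elim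
  have opp := aux_opp z hΦ hu m₁ m₂
  rcases hε₁ with rfl | rfl <;> rcases hε₂ with rfl | rfl
  · exact ⟨rfl, same (by simpa using h)⟩
  · exact (opp (by simpa using h)).elim
  · refine (opp ?_).elim
    rw [← dvd_neg]; convert h using 1; ring
  · refine ⟨rfl, same ?_⟩
    rw [← dvd_neg]; convert h using 1; ring
end

section
/- Let K = ℚ(ζ₉) be the 9th cyclotomic field, let σ be the automorphism of K determined by σ(ζ₉) = ζ₉² (a generator of the cyclic group Gal(K/ℚ)), and let 𝔩 = (1 − ζ₉)·𝒪_K. Then there exists a Shimura ideal character of type (σ, 𝔩⁴). -/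
open NumberField

/-- The action of `τ ∈ Gal(K/ℚ)` on ideals of the ring of integers of `K`,
via the restriction of `τ` to `𝓞 K`. -/
noncomputable def idealConj {K : Type*} [Field K] [NumberField K] (τ : K ≃ₐ[ℚ] K)
    (I : Ideal (𝓞 K)) : Ideal (𝓞 K) :=
  Ideal.map (galRestrict ℤ ℚ K (𝓞 K) τ) I

/-- The cubic subfield `F` of `K`: the fixed field of `ρ = σ³`. -/
noncomputable def cubicFixedField {K : Type*} [Field K] [NumberField K] (σ : K ≃ₐ[ℚ] K) :
    IntermediateField ℚ K :=
  IntermediateField.fixedField (Subgroup.zpowers (σ ^ 3))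

/-- A *Shimura ideal character of type `(σ, 𝔠)`* on a sextic cyclic CM field `K` with
`σ` a generator of `Gal(K/ℚ)`, `ρ = σ³`, and `F` the cubic subfield (fixed field of `ρ`):
a map `ψ` from the nonzero ideals of `𝓞 K` coprime to `𝔠` to the nonzero elements of `K`
such that
(i)   `ψ (I * J) = ψ I * ψ J`;
(ii)  `ψ (s 𝓞 K) = s • σ⁴ s • σ⁵ s` whenever `s ≡ 1 mod 𝔠`;
(iii) for a prime `𝔭` of `𝓞 F` unramified in `K` (coprime to `𝔠`), `ψ (𝔭 𝓞 K) = N 𝔭`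
      if `𝔭` splits in `K` and `ψ (𝔭 𝓞 K) = -N 𝔭` if `𝔭 𝓞 K` is prime;
(iv)  `ψ I * ρ (ψ I) = N I` and `ψ I • 𝓞 K = I • σ⁴ I • σ⁵ I` as (fractional) ideals;
(v)   `ψ (σ I) = σ (ψ I)`.
Here the absolute norm `N` of an ideal is the cardinality of the corresponding quotient. -/
noncomputable def IsShimuraIdealChar {K : Type*} [Field K] [NumberField K]
    (σ : K ≃ₐ[ℚ] K) (𝔠 : Ideal (𝓞 K)) (ψ : Ideal (𝓞 K) → K) : Prop :=
  -- ψ takes nonzero values on nonzero ideals coprime to 𝔠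
  (∀ I : Ideal (𝓞 K), I ≠ ⊥ → IsCoprime I 𝔠 → ψ I ≠ 0) ∧
  -- (i) multiplicativity
  (∀ I J : Ideal (𝓞 K), I ≠ ⊥ → J ≠ ⊥ → IsCoprime I 𝔠 → IsCoprime J 𝔠 →
    ψ (I * J) = ψ I * ψ J) ∧
  -- (ii) value on principal ideals generated by `s ≡ 1 mod 𝔠`
  (∀ s : 𝓞 K, IsCoprime (Ideal.span {s}) 𝔠 → s - 1 ∈ 𝔠 →
    ψ (Ideal.span {s}) = (s : K) * (σ ^ 4) (s : K) * (σ ^ 5) (s : K)) ∧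
  -- (iii) value on primes of the cubic subfield `F` unramified in `K`: such a prime either
  -- splits (`𝔭 𝓞 K` is a product of two distinct primes) or is inert (`𝔭 𝓞 K` is prime)
  (∀ 𝔭 : Ideal (𝓞 (cubicFixedField σ)), 𝔭.IsPrime → 𝔭 ≠ ⊥ →
    IsCoprime (Ideal.map (algebraMap (𝓞 (cubicFixedField σ)) (𝓞 K)) 𝔭) 𝔠 →
    ((∃ Q₁ Q₂ : Ideal (𝓞 K), Q₁.IsPrime ∧ Q₂.IsPrime ∧ Q₁ ≠ Q₂ ∧
        Ideal.map (algebraMap (𝓞 (cubicFixedField σ)) (𝓞 K)) 𝔭 = Q₁ * Q₂) →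
      ψ (Ideal.map (algebraMap (𝓞 (cubicFixedField σ)) (𝓞 K)) 𝔭)
        = (Nat.card (𝓞 (cubicFixedField σ) ⧸ 𝔭) : K)) ∧
    ((Ideal.map (algebraMap (𝓞 (cubicFixedField σ)) (𝓞 K)) 𝔭).IsPrime →
      ψ (Ideal.map (algebraMap (𝓞 (cubicFixedField σ)) (𝓞 K)) 𝔭)
        = -(Nat.card (𝓞 (cubicFixedField σ) ⧸ 𝔭) : K))) ∧
  -- (iv) norm relation and ideal generation
  (∀ I : Ideal (𝓞 K), I ≠ ⊥ → IsCoprime I 𝔠 →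
    ψ I * (σ ^ 3) (ψ I) = (Nat.card (𝓞 K ⧸ I) : K) ∧
    FractionalIdeal.spanSingleton (nonZeroDivisors (𝓞 K)) (ψ I)
      = ((I * idealConj (σ ^ 4) I * idealConj (σ ^ 5) I : Ideal (𝓞 K)) :
          FractionalIdeal (nonZeroDivisors (𝓞 K)) K)) ∧
  -- (v) Galois equivariance with respect to σ
  (∀ I : Ideal (𝓞 K), I ≠ ⊥ → IsCoprime I 𝔠 → ψ (idealConj σ I) = σ (ψ I))

namespace Shim

lemma step_lemma {R : Type*} [CommRing R] (x : R) (h3 : x ∣ 3)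
    (hres : ∀ a : R, x ∣ a ∨ x ∣ a - 1 ∨ x ∣ a + 1)
    (j : ℕ) (w : Rˣ) (e : R) (hw : (w : R) = 1 + x ^ (j + 1) * e) (he : ¬ x ∣ e)
    (a : R) (ha : x ^ (j + 1) ∣ a - 1) :
    ∃ u : Rˣ, x ^ (j + 2) ∣ u * a - 1 := by
  obtain ⟨b, hb⟩ := ha
  have ha' : a = 1 + x ^ (j + 1) * b := by linear_combination hb
  obtain ⟨t, ht⟩ := h3
  have key : x ∣ b ∨ x ∣ b + e ∨ x ∣ b - e := by
    rcases hres b with h | h | h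
    · exact Or.inl h
    · rcases hres e with h' | h' | h'
      · exact absurd h' he
      · right; right
        have := dvd_sub h h'
        convert this using 1; ring
      · right; left
        have := dvd_add h h'
        convert this using 1; ring
    · rcases hres e with h' | h' | h'
      · exact absurd h' he
      · right; left
        have := dvd_add h h'
        convert this using 1; ring
      · right; right
        have := dvd_sub h h'
        convert this using 1; ring
  rcases key with ⟨c, hc⟩ | ⟨c, hc⟩ | ⟨c, hc⟩
  · refine ⟨1, c, ?_⟩
    rw [ha', hc]; push_cast; ring
  · refine ⟨w, c + x ^ j * e * b, ?_⟩
    rw [ha', hw]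
    linear_combination x ^ (j + 1) * hc
  · refine ⟨w ^ 2, c + t * e + x ^ j * (e ^ 2 + 2 * e * b + x ^ (j + 1) * e ^ 2 * b), ?_⟩
    push_cast
    rw [ha', hw]
    linear_combination x ^ (j + 1) * hc + x ^ (j + 1) * e * ht

/-- Units surject onto `(R/x^4)ˣ`. -/
lemma unit_lemma {R : Type*} [CommRing R] (x z t : R) (hxz : x = 1 - z) (ht : 3 = x ^ 6 * t)
    (hz : 1 + z ^ 3 + z ^ 6 = 0) (hnu : ¬ IsUnit x)
    (hres : ∀ a : R, x ∣ a ∨ x ∣ a - 1 ∨ x ∣ a + 1)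
    (a : R) (ha : ¬ x ∣ a) :
    ∃ u : Rˣ, x ^ 4 ∣ u * a - 1 := by
  have hz9 : z ^ 9 = 1 := by linear_combination (z ^ 3 - 1) * hz
  have h3 : x ∣ 3 := ⟨x ^ 5 * t, by rw [ht]; ring⟩
  have hunit : ∀ c : R, ¬ x ∣ 1 + x * c := fun c h => hnu <| isUnit_of_dvd_one <| by
    have := dvd_sub h (Dvd.intro c rfl : x ∣ x * c)
    simpa using this
  obtain ⟨u0, h0⟩ : ∃ u : Rˣ, x ∣ u * a - 1 := by
    rcases hres a with h | h | h
    · exact absurd h ha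
    · exact ⟨1, by simpa using h⟩
    · refine ⟨-1, ?_⟩
      rw [← dvd_neg]
      convert h using 1
      push_cast; ring
  let zu : Rˣ := ⟨z, z ^ 8, by linear_combination hz9, by linear_combination hz9⟩
  let wu : Rˣ := ⟨-z ^ 8 * (1 + z ^ 2), - z * (1 + z ^ 4 + z ^ 8 + z ^ 3 + z ^ 7), by
      linear_combination (1 + z ^ 2) * (1 + z ^ 4 + z ^ 8 + z ^ 3 + z ^ 7) * hz9
        + (1 + z) * hz9 + (1 + z + z ^ 2) * hz, by
      linear_combination (1 + z ^ 2) * (1 + z ^ 4 + z ^ 8 + z ^ 3 + z ^ 7) * hz9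
        + (1 + z) * hz9 + (1 + z + z ^ 2) * hz⟩
  obtain ⟨u1, h1⟩ := step_lemma x h3 hres 0 zu (-1) (by simp [zu, hxz]) (by
    rw [dvd_neg]; intro h; exact hnu (isUnit_of_dvd_one h)) _ (by simpa using h0)
  obtain ⟨u2, h2⟩ := step_lemma x h3 hres 1 wu (-z ^ 8 * (1 + x ^ 4 * t * z)) (by
      simp only [wu]
      linear_combination (-z ^ 9) * ht + z ^ 8 * (x + 1 - z) * hxz + hz9) (by
    intro h
    have h' : x ∣ -z * (-z ^ 8 * (1 + x ^ 4 * t * z)) := Dvd.dvd.mul_left h _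
    apply hunit (x ^ 3 * t * z)
    convert h' using 1
    linear_combination -(1 + x ^ 4 * t * z) * hz9) _ h1
  obtain ⟨u3, h3⟩ := step_lemma x h3 hres 2 (zu ^ 3) (-(1 + x * (x ^ 3 * t * (1 - x)))) (by
      have : z = 1 - x := by rw [hxz]; ring
      simp only [zu, Units.val_pow_eq_pow_val]
      rw [this]
      linear_combination (- x + x ^ 2) * ht) (by
    rw [dvd_neg]; exact hunit _) _ h2
  refine ⟨u3 * u2 * u1 * u0, ?_⟩
  convert h3 using 1
  push_cast; ring

open Polynomial InfinitePlace Nat Real cyclotomic in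
theorem nine_pid (K : Type*) [Field K] [NumberField K] [IsCyclotomicExtension {9} ℚ K] :
    IsPrincipalIdealRing (𝓞 K) := by
  have i3 : Fact (Nat.Prime 3) := ⟨Nat.prime_three⟩
  have i2 : Fact (Nat.Prime 2) := ⟨Nat.prime_two⟩
  have hK : IsCyclotomicExtension {3 ^ (1 + 1)} ℚ K := by norm_num; infer_instance
  have : IsGalois ℚ K := IsCyclotomicExtension.isGalois {9} ℚ K
  have hphi : Nat.totient 9 = 6 := by decide
  have hM : ⌊(4 / π) ^ nrComplexPlaces K *
      ((Module.finrank ℚ K)! / (Module.finrank ℚ K) ^ (Module.finrank ℚ K) * √|discr K|)⌋₊ ≤ 4 := by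
    rw [IsCyclotomicExtension.Rat.discr_prime_pow_succ 3 1 K, IsCyclotomicExtension.finrank (n := 9) K
      (irreducible_rat (by simp)), IsCyclotomicExtension.Rat.nrComplexPlaces_eq_totient_div_two 9, hphi]
    rw [← Nat.lt_succ_iff, Nat.floor_lt (by positivity)]
    have h6 : (6 ! : ℝ) = 720 := by norm_num [Nat.factorial]
    have hs : √(19683 : ℝ) < 141 := by
      rw [Real.sqrt_lt' (by norm_num)]; norm_num
    have hpi : 4 / π < 4 / 3.14 := by
      have := Real.pi_gt_d2
      gcongr
    have hpi0 : 0 < 4 / π := by positivity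
    norm_num [h6, abs_of_pos]
    calc (4 / π) ^ 3 * (5 / 324 * √19683) ≤ (4 / 3.14) ^ 3 * (5 / 324 * 141) := by
          gcongr
      _ < 5 := by norm_num
  refine RingOfIntegers.isPrincipalIdealRing_of_isPrincipal_of_pow_le_of_mem_primesOver_of_mem_Icc ?_
  intro p hp hpp P hP hle
  have hp4 : p ≤ 4 := (Finset.mem_Icc.mp hp).2.trans hM
  have hle4 := hle.trans hM
  have h1 := hP.1
  have h2 := hP.2
  interval_cases p
  · exact absurd hpp (by norm_num)
  · exact absurd hpp (by norm_num)
  · exfalso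
    rw [IsCyclotomicExtension.Rat.inertiaDeg_eq_of_not_dvd 2 K P (m := 9) (by norm_num)] at hle4
    have : orderOf ((2 : ℕ) : ZMod 9) = 6 := by
      rw [orderOf_eq_iff (by norm_num)]
      decide
    rw [this] at hle4
    norm_num at hle4
  · rw [IsCyclotomicExtension.Rat.eq_span_zeta_sub_one_of_liesOver 3 1 K hK.zeta_spec P]
    exact ⟨_, rfl⟩
  · exact absurd hpp (by norm_num)

end Shim
namespace Shim

section basics
variable {K : Type*} [Field K] [NumberField K] [IsCyclotomicExtension {9} ℚ K]
    {ζ : K} (hζ : IsPrimitiveRoot ζ 9)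

lemma cyc : IsCyclotomicExtension {3 ^ (1 + 1)} ℚ K := by norm_num; infer_instance

omit [NumberField K] [IsCyclotomicExtension {9} ℚ K] in
include hζ in
lemma zrel : 1 + ζ ^ 3 + ζ ^ 6 = 0 := by
  have h9 : ζ ^ 9 = 1 := hζ.pow_eq_one
  have h3 : ζ ^ 3 ≠ 1 := hζ.pow_ne_one_of_pos_of_lt (by norm_num) (by norm_num)
  have : (ζ ^ 3 - 1) * (1 + ζ ^ 3 + ζ ^ 6) = 0 := by linear_combination h9
  exact (mul_eq_zero.mp this).resolve_left (sub_ne_zero.mpr h3)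

include hζ in
lemma basics {x : 𝓞 K} (hx : (x : K) = 1 - ζ) :
    ∃ z : 𝓞 K, (z : K) = ζ ∧ x = 1 - z ∧ 1 + z ^ 3 + z ^ 6 = 0 ∧ Prime x ∧
      (∃ t, IsUnit t ∧ 3 = x ^ 6 * t) ∧ (∀ n : ℤ, x ∣ (n : 𝓞 K) ↔ 3 ∣ n) ∧
      (∀ a : 𝓞 K, x ∣ a ∨ x ∣ a - 1 ∨ x ∣ a + 1) := by
  have i3 : Fact (Nat.Prime 3) := ⟨Nat.prime_three⟩
  have hK : IsCyclotomicExtension {3 ^ (1 + 1)} ℚ K := cyc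
  have hζ' : IsPrimitiveRoot ζ (3 ^ (1 + 1)) := hζ
  have hzc : algebraMap (𝓞 K) K hζ.toInteger = ζ := rfl
  have hxz : x = 1 - hζ.toInteger := by
    apply RingOfIntegers.ext
    rw [hx]; simp [hzc]
  have hxz' : x = - (hζ'.toInteger - 1) := by rw [hxz]; exact (neg_sub _ _).symm
  have hpr : Prime x := by rw [hxz']; exact hζ'.zeta_sub_one_prime.neg
  have hint : ∀ n : ℤ, x ∣ (n : 𝓞 K) ↔ 3 ∣ n := by
    intro n
    rw [hxz', neg_dvd]
    exact IsCyclotomicExtension.Rat.zeta_sub_one_dvd_intCast_iff 3 1 hζ'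
  refine ⟨hζ.toInteger, rfl, hxz, ?_, hpr, ?_, hint, ?_⟩
  · apply RingOfIntegers.ext
    simpa [hzc] using zrel hζ
  · have h := IsCyclotomicExtension.Rat.map_eq_span_zeta_sub_one_pow 3 1 hζ'
    rw [← Ideal.span_singleton_neg (hζ'.toInteger - 1), ← hxz', Ideal.map_span, Set.image_singleton,
      Ideal.span_singleton_pow, Ideal.span_singleton_eq_span_singleton,
      IsCyclotomicExtension.finrank (n := 9) K
      (Polynomial.cyclotomic.irreducible_rat (by simp)), show Nat.totient 9 = 6 by decide] at h
    obtain ⟨u, hu⟩ := h.symm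
    refine ⟨u, u.isUnit, ?_⟩
    rw [hu]; simp
  · intro a
    have hex : ∃ n : ℤ, x ∣ a - n := by
      have htop : a ∈ Algebra.adjoin ℤ {hζ.toInteger} := by
        rw [IsCyclotomicExtension.Rat.adjoin_singleton_eq_top hζ]; trivial
      induction htop using Algebra.adjoin_induction with
      | mem y hy =>
        rw [Set.mem_singleton_iff] at hy
        exact ⟨1, -1, by rw [hy, hxz]; push_cast; ring⟩
      | algebraMap r => exact ⟨r, by simp⟩
      | add a b _ _ ha hb =>
        obtain ⟨m, hm⟩ := ha
        obtain ⟨n, hn⟩ := hb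
        refine ⟨m + n, ?_⟩
        convert dvd_add hm hn using 1
        push_cast; ring
      | mul a b _ _ ha hb =>
        obtain ⟨m, hm⟩ := ha
        obtain ⟨n, hn⟩ := hb
        refine ⟨m * n, ?_⟩
        convert dvd_add (hm.mul_right b) (hn.mul_left (m : 𝓞 K)) using 1
        push_cast; ring
    obtain ⟨n, hn⟩ := hex
    have h3 : 3 ∣ n ∨ 3 ∣ n - 1 ∨ 3 ∣ n + 1 := by omega
    rcases h3 with h | h | h
    · left
      have := dvd_add hn ((hint _).mpr h)
      simpa using this
    · right; left
      have := dvd_add hn ((hint _).mpr h)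
      convert this using 1
      push_cast; ring
    · right; right
      have := dvd_add hn ((hint _).mpr h)
      convert this using 1
      push_cast; ring

include hζ in
/-- The only root of unity congruent to `1` modulo `x^4` is `1`. -/
lemma root_eq_one {x : 𝓞 K} (hx : (x : K) = 1 - ζ) (v : 𝓞 K) (hv : IsOfFinOrder (v : K))
    (h1 : x ^ 4 ∣ v - 1) : v = 1 := by
  obtain ⟨z, hzζ, hxz, hz, hpr, ⟨t, htu, ht⟩, hint, -⟩ := basics hζ hx
  obtain ⟨r, hr⟩ := IsPrimitiveRoot.exists_neg_pow_of_isOfFinOrder (n := 9) (by decide) hζ hv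
  have hr' : v = (-z) ^ r := by
    apply RingOfIntegers.ext
    rw [hr]; simp [hzζ]
  have hz9 : z ^ 9 = 1 := by linear_combination (z ^ 3 - 1) * hz
  have hx1 : x ∣ v - 1 := (dvd_pow_self x (by norm_num)).trans h1
  have hzr : ∀ r, x ∣ z ^ r - 1 := by
    intro r
    have := sub_dvd_pow_sub_pow z 1 r
    rw [one_pow] at this
    rw [hxz, ← neg_sub, neg_dvd]
    exact this
  have hev : Even r := by
    by_contra hodd
    rw [Nat.not_even_iff_odd] at hodd
    rw [hr', hodd.neg_pow] at hx1
    have := dvd_add hx1 (hzr r)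
    have h2 : x ∣ ((-2 : ℤ) : 𝓞 K) := by
      convert this using 1
      push_cast; ring
    rw [hint] at h2
    norm_num at h2
  rw [hev.neg_pow] at hr'
  have hn4 : ¬ x ^ 4 ∣ z ^ 3 - 1 := by
    rintro ⟨c, hc⟩
    have h8 : x ^ 6 * t = x ^ 6 * (x ^ 2 * (c ^ 2 * (-z ^ 6))) := by
      rw [← ht]
      have e1 : x ^ 6 * (x ^ 2 * (c ^ 2 * (-z ^ 6))) = -z ^ 6 * (x ^ 4 * c) ^ 2 := by ring
      rw [e1, ← hc]
      linear_combination (z ^ 6 - 3 * z ^ 3 + 3) * hz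
    have := mul_left_cancel₀ (pow_ne_zero 6 hpr.ne_zero) h8
    apply hpr.not_isUnit
    apply isUnit_of_dvd_unit _ htu
    rw [this]
    exact Dvd.intro (x * (c ^ 2 * -z ^ 6)) (by ring)
  by_cases h9 : r % 9 = 0
  · rw [hr', ← Nat.div_add_mod r 9, h9, add_zero, pow_mul, hz9, one_pow]
  · exfalso
    apply hn4
    obtain ⟨m, hm⟩ : ∃ m, (r * m) % 9 = 3 := by
      have : r % 9 < 9 := Nat.mod_lt _ (by norm_num)
      have hall : ∀ s < 9, s ≠ 0 → ∃ m < 9, (s * m) % 9 = 3 := by decide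
      obtain ⟨m, -, hm⟩ := hall _ this h9
      exact ⟨m, by rw [Nat.mul_mod, ← hm]; simp [Nat.mul_mod]⟩
    have hd : x ^ 4 ∣ v ^ m - 1 := by
      refine h1.trans ?_
      have := sub_dvd_pow_sub_pow v 1 m
      rwa [one_pow] at this
    rw [hr', ← pow_mul, ← Nat.div_add_mod (r * m) 9, hm, pow_add, pow_mul, hz9] at hd
    simpa using hd

end basics
end Shim
namespace Shim

section gal
variable {K : Type*} [Field K] [NumberField K]

/-- The action of `σ ^ k` on integers. -/
noncomputable def g (σ : K ≃ₐ[ℚ] K) (k : ℕ) : 𝓞 K ≃ₐ[ℤ] 𝓞 K := galRestrict ℤ ℚ K (𝓞 K) (σ ^ k)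

lemma coe_g (σ : K ≃ₐ[ℚ] K) (k : ℕ) (a : 𝓞 K) : ((g σ k a : 𝓞 K) : K) = (σ ^ k) (a : K) :=
  algebraMap_galRestrict_apply ℤ (σ ^ k) a

/-- The type norm on integers. -/
noncomputable def tn (σ : K ≃ₐ[ℚ] K) (a : 𝓞 K) : 𝓞 K := a * g σ 4 a * g σ 5 a

lemma tn_mul (σ : K ≃ₐ[ℚ] K) (a b : 𝓞 K) : tn σ (a * b) = tn σ a * tn σ b := by
  simp only [tn, map_mul]; ring

lemma coe_tn (σ : K ≃ₐ[ℚ] K) (a : 𝓞 K) :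
    (tn σ a : K) = (a : K) * (σ ^ 4) (a : K) * (σ ^ 5) (a : K) := by
  simp only [tn, map_mul, coe_g]

lemma g_tn (σ : K ≃ₐ[ℚ] K) (k : ℕ) (a : 𝓞 K) : tn σ (g σ k a) = g σ k (tn σ a) := by
  apply RingOfIntegers.ext
  simp only [coe_g, coe_tn, map_mul, ← AlgEquiv.mul_apply, ← pow_add, add_comm]

variable [IsCyclotomicExtension {9} ℚ K]
    {ζ : K} (hζ : IsPrimitiveRoot ζ 9) {σ : K ≃ₐ[ℚ] K} (hσ : σ ζ = ζ ^ 2)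

include hσ in
lemma sig_pow (k : ℕ) : (σ ^ k) ζ = ζ ^ (2 ^ k) := by
  induction k with
  | zero => simp
  | succ n ih => rw [pow_succ', AlgEquiv.mul_apply, ih, map_pow, hσ, ← pow_mul, pow_succ, mul_comm]

include hζ in
lemma card_gal : Fintype.card (K ≃ₐ[ℚ] K) = 6 := by
  have : IsGalois ℚ K := IsCyclotomicExtension.isGalois {9} ℚ K
  rw [← Nat.card_eq_fintype_card, IsGalois.card_aut_eq_finrank,
    IsCyclotomicExtension.finrank (n := 9) K (Polynomial.cyclotomic.irreducible_rat (by simp))]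
  decide

include hζ in
lemma sig_six : σ ^ 6 = 1 := by
  rw [← card_gal hζ]; exact pow_card_eq_one

include hζ hσ in
lemma sig_bij : Function.Bijective (fun i : Fin 6 => σ ^ (i : ℕ)) := by
  rw [Fintype.bijective_iff_injective_and_card]
  refine ⟨fun i j h => ?_, by rw [card_gal hζ]; simp⟩
  have h1 := congrArg (fun f : K ≃ₐ[ℚ] K => f ζ) h
  simp only [sig_pow hσ] at h1
  rw [← pow_mod_orderOf ζ (2 ^ (i : ℕ)), ← pow_mod_orderOf ζ (2 ^ (j : ℕ)), ← hζ.eq_orderOf] at h1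
  have := hζ.pow_inj (Nat.mod_lt _ (by norm_num)) (Nat.mod_lt _ (by norm_num)) h1
  clear h h1
  revert i j
  decide

include hζ hσ in
lemma conj_eq (φ : K →+* ℂ) (a : K) : φ ((σ ^ 3) a) = (starRingEnd ℂ) (φ a) := by
  have hn : ‖φ ζ‖ = 1 := by
    apply Complex.norm_eq_one_of_pow_eq_one (n := 9) _ (by norm_num)
    rw [← map_pow, hζ.pow_eq_one, map_one]
  have h9 : (φ ζ) ^ 9 = 1 := by rw [← map_pow, hζ.pow_eq_one, map_one]
  let f1 : K →ₐ[ℚ] ℂ := (φ.comp ((σ ^ 3 : K ≃ₐ[ℚ] K) : K →+* K)).toRatAlgHom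
  let f2 : K →ₐ[ℚ] ℂ := ((starRingEnd ℂ).comp φ).toRatAlgHom
  have : f1 = f2 := by
    apply (hζ.powerBasis ℚ).algHom_ext
    rw [hζ.powerBasis_gen ℚ]
    change φ ((σ ^ 3) ζ) = (starRingEnd ℂ) (φ ζ)
    rw [sig_pow hσ, map_pow, ← Complex.inv_eq_conj hn]
    apply eq_inv_of_mul_eq_one_left
    rw [← pow_succ]; exact h9
  exact congrArg (fun f : K →ₐ[ℚ] ℂ => f a) this

include hζ hσ in
lemma norm_tn (a : 𝓞 K) :
    (tn σ a : K) * (σ ^ 3) (tn σ a : K) = (Ideal.absNorm (Ideal.span {a}) : K) := by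
  have : IsGalois ℚ K := IsCyclotomicExtension.isGalois {9} ℚ K
  have h6 : σ ^ 6 = 1 := sig_six hζ
  have h7 : σ ^ 7 = σ := by rw [pow_succ, h6, one_mul]
  have h8 : σ ^ 8 = σ ^ 2 := by rw [pow_add σ 6 2, h6, one_mul]
  have hprod : (tn σ a : K) * (σ ^ 3) (tn σ a : K) = algebraMap ℚ K (Algebra.norm ℚ (a : K)) := by
    rw [Algebra.norm_eq_prod_automorphisms,
      ← Fintype.prod_bijective _ (sig_bij hζ hσ) (fun i => (σ ^ (i : ℕ)) (a : K)) _ (fun _ => rfl)]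
    simp only [coe_tn, map_mul, ← AlgEquiv.mul_apply, ← pow_add, Fin.prod_univ_six]
    norm_num [h7, h8]
    ring
  have hpos : 0 ≤ Algebra.norm ℤ a := by
    obtain ⟨φ⟩ : Nonempty (K →+* ℂ) := inferInstance
    have h1 := congrArg φ hprod
    rw [map_mul, conj_eq hζ hσ, Complex.mul_conj, ← Algebra.coe_norm_int] at h1
    have h2 : ((Complex.normSq (φ (tn σ a : K)) : ℝ) : ℂ) = (((Algebra.norm ℤ a : ℤ) : ℝ) : ℂ) := by
      rw [h1]; simp
    have h3 := Complex.ofReal_injective h2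
    have := Complex.normSq_nonneg (φ (tn σ a : K))
    rw [h3] at this
    exact_mod_cast this
  rw [hprod, ← Algebra.coe_norm_int, Ideal.absNorm_span_singleton]
  have : ((Algebra.norm ℤ a).natAbs : ℤ) = Algebra.norm ℤ a := Int.natAbs_of_nonneg hpos
  rw [← Int.cast_natCast (R := K), this]
  simp

include hζ hσ in
lemma dvd_g {x : 𝓞 K} (hx : (x : K) = 1 - ζ) (k : ℕ) : x ∣ g σ k x := by
  obtain ⟨z, hzζ, hxz, -⟩ := basics hζ hx
  have : g σ k z = z ^ (2 ^ k) := by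
    apply RingOfIntegers.ext
    rw [coe_g, hzζ, sig_pow hσ]; simp [hzζ]
  rw [hxz, map_sub, map_one, this]
  have := sub_dvd_pow_sub_pow 1 z (2 ^ k)
  rwa [one_pow] at this

include hζ hσ in
lemma g_cong {x : 𝓞 K} (hx : (x : K) = 1 - ζ) (k : ℕ) {a : 𝓞 K} (ha : x ^ 4 ∣ a - 1) :
    x ^ 4 ∣ g σ k a - 1 := by
  have h := map_dvd (g σ k) ha
  rw [map_sub, map_one, map_pow] at h
  exact (pow_dvd_pow_of_dvd (dvd_g hζ hσ hx k) 4).trans h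

lemma mul_cong {R : Type*} [CommRing R] {y a b : R} (ha : y ∣ a - 1) (hb : y ∣ b - 1) :
    y ∣ a * b - 1 := by
  convert dvd_add (ha.mul_right b) hb using 1
  ring

include hζ hσ in
lemma tn_cong {x : 𝓞 K} (hx : (x : K) = 1 - ζ) {a : 𝓞 K} (ha : x ^ 4 ∣ a - 1) :
    x ^ 4 ∣ tn σ a - 1 :=
  mul_cong (mul_cong ha (g_cong hζ hσ hx 4 ha)) (g_cong hζ hσ hx 5 ha)

include hζ hσ in
lemma tn_well {x : 𝓞 K} (hx : (x : K) = 1 - ζ) {a b : 𝓞 K} (ha : x ^ 4 ∣ a - 1)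
    (hb : x ^ 4 ∣ b - 1) (hab : Ideal.span {a} = Ideal.span {b}) : tn σ a = tn σ b := by
  rw [Ideal.span_singleton_eq_span_singleton] at hab
  obtain ⟨u, hu⟩ := hab
  have hu1 : x ^ 4 ∣ (u : 𝓞 K) - 1 := by
    have h1 : x ^ 4 ∣ b - u := by
      rw [← hu]
      convert ha.mul_right (u : 𝓞 K) using 1
      ring
    convert dvd_sub hb h1 using 1
    ring
  have hv : tn σ (u : 𝓞 K) = 1 := by
    refine root_eq_one hζ hx _ ?_ (tn_cong hζ hσ hx hu1)
    have hnorm := norm_tn hζ hσ (u : 𝓞 K)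
    rw [Ideal.span_singleton_eq_top.mpr u.isUnit, Ideal.absNorm_top, Nat.cast_one] at hnorm
    obtain ⟨n, hn, h1⟩ := NumberField.Embeddings.pow_eq_one_of_norm_eq_one K ℂ
      (x := (tn σ (u : 𝓞 K) : K)) (RingOfIntegers.isIntegral_coe _) (fun φ => by
        have h := congrArg φ hnorm
        rw [map_mul, conj_eq hζ hσ, Complex.mul_conj, map_one, Complex.normSq_eq_norm_sq] at h
        have h' : ‖φ (tn σ (u : 𝓞 K) : K)‖ ^ 2 = 1 := by exact_mod_cast h
        exact (pow_eq_one_iff_of_nonneg (norm_nonneg _) (by norm_num)).mp h')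
    exact isOfFinOrder_iff_pow_eq_one.mpr ⟨n, hn, h1⟩
  rw [← hu, tn_mul, hv, mul_one]

end gal
end Shim
namespace Shim

lemma card_of_root {L : Type*} [Field L] [Finite L] (w : L) (hw : w ^ 2 + w + 1 = 0)
    (h3 : (3 : L) ≠ 0) : 3 ∣ Nat.card L - 1 := by
  have i3 : Fact (Nat.Prime 3) := ⟨Nat.prime_three⟩
  have hw3 : w ^ 3 = 1 := by linear_combination (w - 1) * hw
  have hw1 : w ≠ 1 := by
    rintro rfl
    apply h3
    linear_combination hw
  have hw0 : w ≠ 0 := by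
    rintro rfl
    norm_num at hw
  have : orderOf (Units.mk0 w hw0) = 3 := by
    apply orderOf_eq_prime
    · ext; simpa using hw3
    · intro h
      exact hw1 (congrArg Units.val h)
  rw [← Nat.card_units, ← this]
  exact orderOf_dvd_natCard _

lemma root_of_card {L : Type*} [Field L] [Finite L] (h : 3 ∣ Nat.card L - 1) :
    ∃ w : L, w ^ 2 + w + 1 = 0 := by
  have i3 : Fact (Nat.Prime 3) := ⟨Nat.prime_three⟩
  rw [← Nat.card_units] at h
  obtain ⟨w, hw⟩ := exists_prime_orderOf_dvd_card' 3 h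
  have hw1 : w ≠ 1 := by
    rintro rfl
    simp at hw
  have hw1' : (w : L) - 1 ≠ 0 := fun h => hw1 (Units.ext (sub_eq_zero.mp h))
  have hw3 : (w : L) ^ 3 = 1 := by
    have := pow_orderOf_eq_one w
    rw [hw] at this
    rw [← Units.val_pow_eq_pow_val, this, Units.val_one]
  refine ⟨w, (mul_eq_zero.mp (?_ : ((w : L) - 1) * _ = 0)).resolve_left hw1'⟩
  linear_combination hw3

section final
variable {K : Type*} [Field K] [NumberField K]

lemma coe_mul_int (a b : 𝓞 K) : ((a * b : 𝓞 K) : K) = (a : K) * (b : K) := map_mul (algebraMap (𝓞 K) K) a b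

open Classical in
/-- The character. -/
noncomputable def psi (σ : K ≃ₐ[ℚ] K) (x : 𝓞 K) (I : Ideal (𝓞 K)) : K :=
  if h : ∃ a : 𝓞 K, I = Ideal.span {a} ∧ x ^ 4 ∣ a - 1 then (tn σ h.choose : K) else 0

lemma conj_span (σ : K ≃ₐ[ℚ] K) (k : ℕ) (a : 𝓞 K) :
    idealConj (σ ^ k) (Ideal.span {a}) = Ideal.span {g σ k a} := by
  rw [idealConj, Ideal.map_span, Set.image_singleton]; rfl

lemma g_alg (σ : K ≃ₐ[ℚ] K) (c : 𝓞 (cubicFixedField σ)) :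
    g σ 3 (algebraMap (𝓞 (cubicFixedField σ)) (𝓞 K) c) =
      algebraMap (𝓞 (cubicFixedField σ)) (𝓞 K) c := by
  apply RingOfIntegers.ext
  rw [coe_g]
  exact (IntermediateField.mem_fixedField_iff _ _).mp (c : cubicFixedField σ).2 (σ ^ 3)
    (Subgroup.mem_zpowers _)

lemma map_stable (σ : K ≃ₐ[ℚ] K) (P : Ideal (𝓞 (cubicFixedField σ))) :
    idealConj (σ ^ 3) (Ideal.map (algebraMap (𝓞 (cubicFixedField σ)) (𝓞 K)) P) =
      Ideal.map (algebraMap (𝓞 (cubicFixedField σ)) (𝓞 K)) P := by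
  rw [idealConj]
  change Ideal.map ((g σ 3 : 𝓞 K ≃ₐ[ℤ] 𝓞 K) : 𝓞 K →+* 𝓞 K) _ = _
  rw [Ideal.map_map]
  congr 1
  ext1 c
  exact g_alg σ c

variable [IsCyclotomicExtension {9} ℚ K]
    {ζ : K} (hζ : IsPrimitiveRoot ζ 9) {σ : K ≃ₐ[ℚ] K} (hσ : σ ζ = ζ ^ 2)
    {x : 𝓞 K} (hx : (x : K) = 1 - ζ)

include hζ hσ hx in
lemma psi_eq {a : 𝓞 K} (ha : x ^ 4 ∣ a - 1) : psi σ x (Ideal.span {a}) = (tn σ a : K) := by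
  have h : ∃ b : 𝓞 K, Ideal.span {a} = Ideal.span {b} ∧ x ^ 4 ∣ b - 1 := ⟨a, rfl, ha⟩
  rw [psi, dif_pos h, tn_well hζ hσ hx h.choose_spec.2 ha h.choose_spec.1.symm]

include hζ hx in
lemma exists_gen {I : Ideal (𝓞 K)} (hI : IsCoprime I (Ideal.span {x} ^ 4)) :
    ∃ a : 𝓞 K, I = Ideal.span {a} ∧ x ^ 4 ∣ a - 1 := by
  obtain ⟨z, hzζ, hxz, hz, hpr, ⟨t, htu, ht⟩, hint, hres⟩ := basics hζ hx
  have := nine_pid K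
  obtain ⟨a, rfl⟩ := (IsPrincipalIdealRing.principal I).principal
  rw [Ideal.submodule_span_eq] at hI ⊢
  have hax : ¬ x ∣ a := by
    intro h
    rw [Ideal.isCoprime_iff_sup_eq] at hI
    apply hpr.not_isUnit
    rw [← Ideal.span_singleton_eq_top, eq_top_iff, ← hI]
    exact sup_le (Ideal.span_singleton_le_span_singleton.mpr h) (Ideal.pow_le_self (by norm_num))
  obtain ⟨u, hu⟩ := unit_lemma x z t hxz ht hz hpr.not_isUnit hres a hax
  refine ⟨u * a, ?_, hu⟩
  rw [Ideal.span_singleton_mul_left_unit u.isUnit]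

lemma not_mem_of_coprime {I Q : Ideal (𝓞 K)} (hQ : Q.IsPrime) {x : 𝓞 K} (hle : I ≤ Q)
    (hI : IsCoprime I (Ideal.span {x} ^ 4)) : x ∉ Q := by
  intro h
  rw [Ideal.isCoprime_iff_sup_eq] at hI
  apply hQ.ne_top
  rw [eq_top_iff, ← hI]
  exact sup_le hle ((Ideal.pow_le_self (by norm_num)).trans
    ((Ideal.span_singleton_le_iff_mem _).mpr h))

include hζ hx in
lemma three_not_mem {Q : Ideal (𝓞 K)} (hQ : Q.IsPrime) (h : x ∉ Q) : (3 : 𝓞 K) ∉ Q := by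
  obtain ⟨z, hzζ, hxz, hz, hpr, ⟨t, htu, ht⟩, hint, hres⟩ := basics hζ hx
  rw [ht]
  intro h3
  rcases hQ.mem_or_mem h3 with h' | h'
  · exact h (hQ.mem_of_pow_mem _ h')
  · exact hQ.ne_top (Ideal.eq_top_of_isUnit_mem _ h' htu)

lemma card_quot {R : Type*} [CommRing R] [IsDedekindDomain R] [Module.Free ℤ R]
    [Module.Finite ℤ R] (I : Ideal R) : Nat.card (R ⧸ I) = Ideal.absNorm I := rfl

include hζ hσ in
lemma absNorm_map (P : Ideal (𝓞 (cubicFixedField σ))) :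
    Ideal.absNorm (Ideal.map (algebraMap (𝓞 (cubicFixedField σ)) (𝓞 K)) P) =
      Ideal.absNorm P ^ 2 := by
  rw [Ideal.absNorm_algebraMap]
  congr 1
  rw [← IsFractionRing.finrank_eq (𝓞 (cubicFixedField σ))
    (cubicFixedField σ) (𝓞 K) K]
  unfold cubicFixedField
  rw [IntermediateField.finrank_fixedField_eq_card, Nat.card_zpowers]
  have i2 : Fact (Nat.Prime 2) := ⟨Nat.prime_two⟩
  apply orderOf_eq_prime
  · rw [← pow_mul]; exact sig_six hζ
  · intro h
    have := @(sig_bij hζ hσ).1 3 0 (by simpa using h)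
    exact absurd this (by decide)

include hζ hσ hx in
lemma split_case (P : Ideal (𝓞 (cubicFixedField σ))) (hP : P.IsPrime) (hP0 : P ≠ ⊥)
    (hc : IsCoprime (Ideal.map (algebraMap (𝓞 (cubicFixedField σ)) (𝓞 K)) P) (Ideal.span {x} ^ 4))
    (Q₁ Q₂ : Ideal (𝓞 K)) (h1 : Q₁.IsPrime) (h2 : Q₂.IsPrime)
    (h : Ideal.map (algebraMap (𝓞 (cubicFixedField σ)) (𝓞 K)) P = Q₁ * Q₂) :
    3 ∣ Ideal.absNorm P - 1 := by
  obtain ⟨z, hzζ, hxz, hz, -⟩ := basics hζ hx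
  have hN := absNorm_map hζ hσ P
  have hmax : P.IsMaximal := hP.isMaximal hP0
  have hPpos : Ideal.absNorm P ≠ 0 := by rwa [Ne, Ideal.absNorm_eq_zero_iff]
  have hle : ∀ Q : Ideal (𝓞 K), Q.IsPrime → Q ≠ ⊥ →
      Ideal.map (algebraMap (𝓞 (cubicFixedField σ)) (𝓞 K)) P ≤ Q →
      Ideal.absNorm P ≤ Ideal.absNorm Q := by
    intro Q hQ hQ0 hle
    rw [← card_quot, ← card_quot]
    letI := Ideal.Quotient.field P
    have : Nontrivial (𝓞 K ⧸ Q) := Ideal.Quotient.nontrivial_iff.mpr hQ.ne_top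
    have : Finite (𝓞 K ⧸ Q) := Ideal.finiteQuotientOfFreeOfNeBot Q hQ0
    exact Nat.card_le_card_of_injective
      (Ideal.quotientMap Q (algebraMap (𝓞 (cubicFixedField σ)) (𝓞 K)) (Ideal.map_le_iff_le_comap.mp hle))
      (RingHom.injective _)
  have hl1 : Ideal.map (algebraMap (𝓞 (cubicFixedField σ)) (𝓞 K)) P ≤ Q₁ := by
    rw [h]; exact Ideal.mul_le_left
  have hl2 : Ideal.map (algebraMap (𝓞 (cubicFixedField σ)) (𝓞 K)) P ≤ Q₂ := by
    rw [h]; exact Ideal.mul_le_right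
  rw [h, map_mul] at hN
  have hQ1 : Q₁ ≠ ⊥ := by
    rintro rfl
    rw [Ideal.absNorm_bot, zero_mul] at hN
    exact pow_ne_zero 2 hPpos hN.symm
  have hQ2 : Q₂ ≠ ⊥ := by
    rintro rfl
    rw [Ideal.absNorm_bot, mul_zero] at hN
    exact pow_ne_zero 2 hPpos hN.symm
  have e1 := hle Q₁ h1 hQ1 hl1
  have e2 := hle Q₂ h2 hQ2 hl2
  have hq : Ideal.absNorm Q₁ = Ideal.absNorm P := by
    apply le_antisymm _ e1
    by_contra hlt
    push Not at hlt
    have : 0 < Ideal.absNorm P := Nat.pos_of_ne_zero hPpos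
    nlinarith
  rw [← hq, ← card_quot]
  have : Q₁.IsMaximal := h1.isMaximal hQ1
  letI := Ideal.Quotient.field Q₁
  have : Finite (𝓞 K ⧸ Q₁) := Ideal.finiteQuotientOfFreeOfNeBot Q₁ hQ1
  apply card_of_root (Ideal.Quotient.mk Q₁ (z ^ 3))
  · rw [← map_pow, ← map_add, ← map_one (Ideal.Quotient.mk Q₁), ← map_add]
    rw [show (z ^ 3) ^ 2 + z ^ 3 + 1 = 0 by linear_combination hz, map_zero]
  · intro h3
    apply three_not_mem hζ hx h1 (not_mem_of_coprime h1 hl1 hc)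
    rw [← Ideal.Quotient.eq_zero_iff_mem]
    exact_mod_cast h3

include hζ hσ hx in
lemma inert_case (P : Ideal (𝓞 (cubicFixedField σ))) (hP : P.IsPrime) (hP0 : P ≠ ⊥)
    (hc : IsCoprime (Ideal.map (algebraMap (𝓞 (cubicFixedField σ)) (𝓞 K)) P) (Ideal.span {x} ^ 4))
    (hQ : (Ideal.map (algebraMap (𝓞 (cubicFixedField σ)) (𝓞 K)) P).IsPrime) :
    ¬ 3 ∣ Ideal.absNorm P - 1 := by
  obtain ⟨z, hzζ, hxz, hz, -⟩ := basics hζ hx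
  have hz9 : z ^ 9 = 1 := by linear_combination (z ^ 3 - 1) * hz
  intro h3
  rw [← card_quot] at h3
  have hmax : P.IsMaximal := hP.isMaximal hP0
  letI := Ideal.Quotient.field P
  have : Finite (𝓞 (cubicFixedField σ) ⧸ P) := Ideal.finiteQuotientOfFreeOfNeBot P hP0
  obtain ⟨w, hw⟩ := root_of_card h3
  obtain ⟨c, rfl⟩ := Ideal.Quotient.mk_surjective w
  have hcP : c ^ 2 + c + 1 ∈ P := by
    rw [← Ideal.Quotient.eq_zero_iff_mem]
    simpa using hw
  set A := algebraMap (𝓞 (cubicFixedField σ)) (𝓞 K) with hA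
  set Q := Ideal.map A P with hQdef
  have hcQ : (A c - z ^ 3) * (A c - z ^ 6) ∈ Q := by
    have := Ideal.mem_map_of_mem A hcP
    convert this using 1
    rw [map_add, map_add, map_pow, map_one]
    linear_combination (- A c) * hz + hz9
  have hst : ∀ y ∈ Q, g σ 3 y ∈ Q := by
    intro y hy
    have := Ideal.mem_map_of_mem (galRestrict ℤ ℚ K (𝓞 K) (σ ^ 3)) hy
    have h2 := map_stable σ P
    rw [idealConj] at h2
    rw [h2] at this
    exact this
  have hgz : g σ 3 z = z ^ 8 := by
    apply RingOfIntegers.ext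
    rw [coe_g, hzζ, sig_pow hσ]; simp [hzζ]
  have hz27 : z ^ 24 = z ^ 6 := by
    linear_combination (z ^ 15 + z ^ 6) * hz9
  have hz48 : z ^ 48 = z ^ 3 := by
    linear_combination (z ^ 39 + z ^ 30 + z ^ 21 + z ^ 12 + z ^ 3) * hz9
  have both : A c - z ^ 3 ∈ Q ∧ A c - z ^ 6 ∈ Q := by
    rcases hQ.mem_or_mem hcQ with h | h
    · refine ⟨h, ?_⟩
      have := hst _ h
      rwa [map_sub, g_alg, map_pow, hgz, ← pow_mul, hz27] at this
    · refine ⟨?_, h⟩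
      have := hst _ h
      rwa [map_sub, g_alg, map_pow, hgz, ← pow_mul, hz48] at this
  have hd := Q.sub_mem both.1 both.2
  apply three_not_mem hζ hx hQ (not_mem_of_coprime hQ le_rfl hc)
  have := Q.mul_mem_left (-(A c - z ^ 3 - (A c - z ^ 6))) hd
  convert this using 1
  linear_combination (z ^ 6 - 3 * z ^ 3 + 3) * hz

end final
end Shim

/-- For `K = ℚ(ζ₉)` the 9th cyclotomic field, with `σ` the generator of `Gal(K/ℚ)` determined
by `σ(ζ₉) = ζ₉²` and `𝔩 = (1 - ζ₉) 𝓞 K` the prime above 3, there exists a Shimura ideal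
character of type `(σ, 𝔩⁴)`. -/
theorem stmt_5 (K : Type*) [Field K] [NumberField K] [IsCyclotomicExtension {9} ℚ K]
    (ζ : K) (hζ : IsPrimitiveRoot ζ 9)
    (σ : K ≃ₐ[ℚ] K) (hσ : σ ζ = ζ ^ 2)
    (x : 𝓞 K) (hx : (x : K) = 1 - ζ) :
    ∃ ψ : Ideal (𝓞 K) → K, IsShimuraIdealChar σ (Ideal.span {x} ^ 4) ψ := by
  have hex := fun {I : Ideal (𝓞 K)} (hI : IsCoprime I (Ideal.span {x} ^ 4)) =>
    Shim.exists_gen hζ hx hI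
  have hpe := fun {a : 𝓞 K} (ha : x ^ 4 ∣ a - 1) => Shim.psi_eq hζ hσ hx ha
  refine ⟨Shim.psi σ x, ?_, ?_, ?_, ?_, ?_, ?_⟩
  · intro I hI0 hI h0
    obtain ⟨a, rfl, ha⟩ := hex hI
    have hn := Shim.norm_tn hζ hσ a
    rw [hpe ha] at h0
    rw [h0, zero_mul] at hn
    have := (Nat.cast_eq_zero.mp hn.symm)
    rw [Ideal.absNorm_eq_zero_iff] at this
    exact hI0 this
  · intro I J _ _ hI hJ
    obtain ⟨a, rfl, ha⟩ := hex hI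
    obtain ⟨b, rfl, hb⟩ := hex hJ
    rw [Ideal.span_singleton_mul_span_singleton, hpe ha, hpe hb, hpe (Shim.mul_cong ha hb),
      Shim.tn_mul, Shim.coe_mul_int]
  · intro s _ hs
    rw [Ideal.span_singleton_pow, Ideal.mem_span_singleton] at hs
    rw [hpe hs, Shim.coe_tn]
  · intro P hP hP0 hc
    obtain ⟨z, hzζ, hxz, hz, hpr, -, hint, hres⟩ := Shim.basics hζ hx
    obtain ⟨a, hIa, ha⟩ := hex hc
    have hst := Shim.map_stable σ P
    have hnorm := Shim.absNorm_map hζ hσ P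
    have hsq : (Shim.tn σ a) ^ 2 = ((Ideal.absNorm P : ℕ) : 𝓞 K) ^ 2 := by
      have h1 := Shim.norm_tn hζ hσ a
      rw [hIa, Shim.conj_span] at hst
      have h2 := Shim.tn_well hζ hσ hx (Shim.g_cong hζ hσ hx 3 ha) ha hst
      rw [Shim.g_tn] at h2
      rw [← Shim.coe_g, h2, ← hIa, hnorm] at h1
      apply RingOfIntegers.ext
      rw [sq, Shim.coe_mul_int, h1]
      simp
    have hcong : x ∣ Shim.tn σ a - 1 :=
      (dvd_pow_self x (by norm_num)).trans (Shim.tn_cong hζ hσ hx ha)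
    have hpos : 1 ≤ Ideal.absNorm P := by
      rw [Nat.one_le_iff_ne_zero, Ne, Ideal.absNorm_eq_zero_iff]; exact hP0
    rcases sq_eq_sq_iff_eq_or_eq_neg.mp hsq with h | h
    · have h3 : 3 ∣ Ideal.absNorm P - 1 := by
        rw [h] at hcong
        have := (hint ((Ideal.absNorm P : ℤ) - 1)).mp (by push_cast; exact hcong)
        omega
      refine ⟨fun _ => ?_, fun hQ => absurd h3 (Shim.inert_case hζ hσ hx P hP hP0 hc hQ)⟩
      rw [hIa, hpe ha, h, Shim.card_quot]
      simp
    · have h3 : ¬ 3 ∣ Ideal.absNorm P - 1 := by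
        rw [h] at hcong
        have := (hint (-(Ideal.absNorm P : ℤ) - 1)).mp (by push_cast; exact hcong)
        omega
      refine ⟨fun ⟨Q₁, Q₂, h1, h2, _, h12⟩ => absurd
        (Shim.split_case hζ hσ hx P hP hP0 hc Q₁ Q₂ h1 h2 h12) h3, fun _ => ?_⟩
      rw [hIa, hpe ha, h, Shim.card_quot]
      simp
  · intro I hI0 hI
    obtain ⟨a, rfl, ha⟩ := hex hI
    rw [hpe ha, Shim.card_quot]
    refine ⟨Shim.norm_tn hζ hσ a, ?_⟩
    rw [Shim.conj_span, Shim.conj_span, Ideal.span_singleton_mul_span_singleton,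
      Ideal.span_singleton_mul_span_singleton, FractionalIdeal.coeIdeal_span_singleton]
    rfl
  · intro I hI0 hI
    obtain ⟨a, rfl, ha⟩ := hex hI
    have h1 := Shim.conj_span σ 1 a
    rw [pow_one] at h1
    rw [h1, hpe ha, hpe (Shim.g_cong hζ hσ hx 1 ha), Shim.g_tn, Shim.coe_g, pow_one]
end

section
/- Let K be a number field of degree 6 over ℚ that is Galois over ℚ with cyclic Galois group, and suppose K contains elements α and β with α³ = 57α − 133 and β² = −19 (so K is the sextic cyclic CM field ℚ(α, √−19) of conductor 19, with class number 1). Then there exist a generator σ of Gal(K/ℚ), a nonzero ideal 𝔠 of 𝒪_K, and a Shimura ideal character of type (σ, 𝔠). -/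
open NumberField

namespace Stmt6
open Polynomial

/-- A monic integer sextic. -/
noncomputable def sx (c5 c4 c3 c2 c1 c0 : ℤ) : ℤ[X] :=
  X ^ 6 + C c5 * X ^ 5 + C c4 * X ^ 4 + C c3 * X ^ 3 + C c2 * X ^ 2 + C c1 * X + C c0

lemma sx_natDegree (c5 c4 c3 c2 c1 c0 : ℤ) : (sx c5 c4 c3 c2 c1 c0).natDegree = 6 := by
  unfold sx; compute_degree!

lemma sx_monic (c5 c4 c3 c2 c1 c0 : ℤ) : (sx c5 c4 c3 c2 c1 c0).Monic := by
  unfold sx; monicity!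

lemma sx_irred {c5 c4 c3 c2 c1 c0 : ℤ} (h5 : 19 ∣ c5) (h4 : 19 ∣ c4) (h3 : 19 ∣ c3) (h2 : 19 ∣ c2)
    (h1 : 19 ∣ c1) (h0 : 19 ∣ c0) (h00 : ¬ 361 ∣ c0) : Irreducible (sx c5 c4 c3 c2 c1 c0) := by
  have hm := sx_monic c5 c4 c3 c2 c1 c0
  have hd := sx_natDegree c5 c4 c3 c2 c1 c0
  refine IsEisensteinAt.irreducible (𝓟 := Ideal.span {(19 : ℤ)}) ?_ ?_ hm.isPrimitive (by omega)
  · refine ⟨?_, ?_, ?_⟩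
    · rw [hm.leadingCoeff, Ideal.mem_span_singleton]; decide
    · intro n hn
      rw [hd] at hn
      rw [Ideal.mem_span_singleton]
      interval_cases n <;> simp [sx, coeff_X, coeff_C, coeff_X_pow, -eq_intCast] <;> assumption
    · rw [Ideal.span_singleton_pow, Ideal.mem_span_singleton]
      simpa [sx] using h00
  · rw [Ideal.span_singleton_prime (by norm_num)]
    exact Int.prime_iff_natAbs_prime.mpr (by norm_num)

variable {K : Type*} [Field K] [NumberField K]

lemma sx_minpoly {c5 c4 c3 c2 c1 c0 : ℤ} (hirr : Irreducible (sx c5 c4 c3 c2 c1 c0))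
    {x : 𝓞 K} (hx : x ^ 6 + c5 * x ^ 5 + c4 * x ^ 4 + c3 * x ^ 3 + c2 * x ^ 2 + c1 * x + c0 = 0) :
    minpoly ℤ x = sx c5 c4 c3 c2 c1 c0 := by
  have hm := sx_monic c5 c4 c3 c2 c1 c0
  have hxi : IsIntegral ℤ x := RingOfIntegers.isIntegral x
  have hdvd : minpoly ℤ x ∣ sx c5 c4 c3 c2 c1 c0 := by
    apply minpoly.isIntegrallyClosed_dvd hxi
    simpa [sx] using hx
  have := hirr.dvd_iff.mp hdvd
  rcases this with h | h
  · exact absurd h (minpoly.not_isUnit ℤ x)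
  · exact eq_of_monic_of_associated (minpoly.monic hxi) hm h.symm

lemma sx_minpolyQ {c5 c4 c3 c2 c1 c0 : ℤ} (hirr : Irreducible (sx c5 c4 c3 c2 c1 c0))
    {x : 𝓞 K} (hx : x ^ 6 + c5 * x ^ 5 + c4 * x ^ 4 + c3 * x ^ 3 + c2 * x ^ 2 + c1 * x + c0 = 0) :
    minpoly ℚ (x : K) = (sx c5 c4 c3 c2 c1 c0).map (algebraMap ℤ ℚ) := by
  have hxi : IsIntegral ℤ x := RingOfIntegers.isIntegral x
  rw [← sx_minpoly hirr hx]
  exact minpoly.isIntegrallyClosed_eq_field_fractions ℚ K hxi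

lemma sx_adjoin (hdeg : Module.finrank ℚ K = 6) {c5 c4 c3 c2 c1 c0 : ℤ} (hirr : Irreducible (sx c5 c4 c3 c2 c1 c0))
    {x : 𝓞 K} (hx : x ^ 6 + c5 * x ^ 5 + c4 * x ^ 4 + c3 * x ^ 3 + c2 * x ^ 2 + c1 * x + c0 = 0) :
    IntermediateField.adjoin ℚ {(x : K)} = ⊤ := by
  rw [Field.primitive_element_iff_minpoly_natDegree_eq, sx_minpolyQ hirr hx, hdeg,
    (sx_monic ..).natDegree_map, sx_natDegree]

lemma sx_norm (hdeg : Module.finrank ℚ K = 6) {c5 c4 c3 c2 c1 c0 : ℤ} (hirr : Irreducible (sx c5 c4 c3 c2 c1 c0))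
    {x : 𝓞 K} (hx : x ^ 6 + c5 * x ^ 5 + c4 * x ^ 4 + c3 * x ^ 3 + c2 * x ^ 2 + c1 * x + c0 = 0)
    (m : ℤ) :
    Ideal.absNorm (Ideal.span {x - (m : 𝓞 K)}) =
      (m ^ 6 + c5 * m ^ 5 + c4 * m ^ 4 + c3 * m ^ 3 + c2 * m ^ 2 + c1 * m + c0).natAbs := by
  rw [Ideal.absNorm_span_singleton]
  congr 1
  have hmp : minpoly ℚ ((x - (m : 𝓞 K) : 𝓞 K) : K) =
      ((sx c5 c4 c3 c2 c1 c0).map (algebraMap ℤ ℚ)).comp (X + C (m : ℚ)) := by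
    rw [← sx_minpolyQ hirr hx, ← minpoly.sub_algebraMap]
    simp
  have hnd : (minpoly ℚ ((x - (m : 𝓞 K) : 𝓞 K) : K)).natDegree = Module.finrank ℚ K := by
    rw [hmp, natDegree_comp, (sx_monic ..).natDegree_map, sx_natDegree, hdeg, natDegree_X_add_C]
  have htop := (Field.primitive_element_iff_minpoly_natDegree_eq ℚ _).mpr hnd
  have hxi : IsIntegral ℚ ((x - (m : 𝓞 K) : 𝓞 K) : K) := Algebra.IsIntegral.isIntegral _
  have h2 := Algebra.norm_eq_norm_adjoin ℚ ((x - (m : 𝓞 K) : 𝓞 K) : K)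
  have hfr : Module.finrank (IntermediateField.adjoin ℚ {((x - (m : 𝓞 K) : 𝓞 K) : K)}) K = 1 := by
    rw [htop, IntermediateField.finrank_top]
  rw [hfr, pow_one] at h2
  have h3 := Algebra.PowerBasis.norm_gen_eq_coeff_zero_minpoly (IntermediateField.adjoin.powerBasis hxi)
  rw [IntermediateField.adjoin.powerBasis_gen, IntermediateField.adjoin.powerBasis_dim,
    IntermediateField.minpoly_gen, hnd, hdeg] at h3
  rw [h3, ← Algebra.coe_norm_int, hmp, coeff_zero_eq_eval_zero] at h2
  have : (((Algebra.norm ℤ) (x - (m : 𝓞 K)) : ℤ) : ℚ) = 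
     ((m ^ 6 + c5 * m ^ 5 + c4 * m ^ 4 + c3 * m ^ 3 + c2 * m ^ 2 + c1 * m + c0 : ℤ) : ℚ) := by
    rw [h2]; simp [sx]; ring
  exact_mod_cast this

lemma sx_diff (hdeg : Module.finrank ℚ K = 6) {c5 c4 c3 c2 c1 c0 : ℤ} (hirr : Irreducible (sx c5 c4 c3 c2 c1 c0))
    {x : 𝓞 K} (hx : x ^ 6 + c5 * x ^ 5 + c4 * x ^ 4 + c3 * x ^ 3 + c2 * x ^ 2 + c1 * x + c0 = 0) :
    6 * x ^ 5 + 5 * c5 * x ^ 4 + 4 * c4 * x ^ 3 + 3 * c3 * x ^ 2 + 2 * c2 * x + c1 ∈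
      differentIdeal ℤ (𝓞 K) := by
  have h := aeval_derivative_mem_differentIdeal ℤ ℚ K x (by
    rw [← IntermediateField.adjoin_simple_toSubalgebra_of_isAlgebraic
      (Algebra.IsAlgebraic.isAlgebraic _), sx_adjoin hdeg hirr hx]; rfl)
  rw [sx_minpoly hirr hx] at h
  convert h using 1
  have hn : ∀ n : ℕ, aeval x (n : ℤ[X]) = (n : 𝓞 K) := fun n => map_natCast _ n
  have h2 := hn 2
  have h3 := hn 3
  have h4 := hn 4
  have h5 := hn 5
  have h6 := hn 6
  push_cast at h2 h3 h4 h5 h6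
  simp [sx, h2, h3, h4, h5, h6]
  ring

/-- the basic integral elements -/
lemma exists_al (α β : K) (hα : α ^ 3 = 57 * α - 133) (hβ : β ^ 2 = (-19 : K)) :
    ∃ a l : 𝓞 K, a ^ 3 + a ^ 2 - 6 * a - 7 = 0 ∧ l ^ 2 = a * l - (a ^ 2 - a - 2) := by
  obtain ⟨a, ha⟩ : ∃ a : K, a = -(α + 1) / 3 := ⟨_, rfl⟩
  have hα' : α = -(3 * a + 1) := by rw [ha]; ring
  have ha3 : a ^ 3 + a ^ 2 - 6 * a - 7 = 0 := by
    rw [hα'] at hα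
    linear_combination (-1/27 : K) * hα
  have hai : IsIntegral ℤ a := by
    refine ⟨X ^ 3 + X ^ 2 - C 6 * X - C 7, by monicity!, ?_⟩
    simpa using ha3
  obtain ⟨l, hl⟩ : ∃ l : K, l = (a + β * (2 * a ^ 2 - 5 * a - 4) / 19) / 2 := ⟨_, rfl⟩
  have hl2 : l ^ 2 = a * l - (a ^ 2 - a - 2) := by
    rw [hl]
    linear_combination (1/4 : K) * ((2 * a ^ 2 - 5 * a - 4) / 19) ^ 2 * hβ + (-(4 * a - 24) / 76) * ha3
  let A : 𝓞 K := ⟨a, hai⟩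
  have hli : IsIntegral (𝓞 K) l := by
    refine ⟨X ^ 2 - C A * X + C (A ^ 2 - A - 2), by monicity!, ?_⟩
    have : algebraMap (𝓞 K) K A = a := rfl
    have h2 : algebraMap (𝓞 K) K 2 = 2 := map_ofNat _ 2
    simp [this, hl2, h2]
  have hli' : IsIntegral ℤ l := isIntegral_trans l hli
  refine ⟨A, ⟨l, hli'⟩, ?_, ?_⟩
  · apply RingOfIntegers.ext; exact ha3
  · apply RingOfIntegers.ext; exact hl2

end Stmt6

namespace Stmt6

section finite
variable {k : Type*} [Field k] [Finite k]

lemma ord_dvd {y : k} {n : ℕ} (hn : n.Prime) (h1 : y ^ n = 1) (h2 : y ≠ 1) :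
    n ∣ Nat.card k - 1 := by
  have := Fintype.ofFinite k
  have : Fact n.Prime := ⟨hn⟩
  have h := orderOf_eq_prime h1 h2
  have hy : y ≠ 0 := by
    rintro rfl
    rw [zero_pow hn.ne_zero] at h1
    exact zero_ne_one h1
  rw [← h, Nat.card_eq_fintype_card]
  exact orderOf_dvd_of_pow_eq_one (FiniteField.pow_card_sub_one_eq_one y hy)

lemma res2 {w z : k} (hw : w ^ 2 - w + 5 = 0) (hz : z ^ 3 + z ^ 2 - 6 * z - 7 = 0) {f : ℕ}
    (hc : Nat.card k = 2 ^ f) (hp : (2 : k) = 0) : 50 < 2 ^ f := by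
  have w2 : w ^ 2 = (1) + (1) * w ^ 1 := by
    have h0 : w ^ 2 = w ^ 1 * w ^ 1 := by ring
    rw [h0]; linear_combination ((1)) * hw + ((-3)) * hp
  have w3 : w ^ 3 = (1) := by
    have h0 : w ^ 3 = w ^ 2 * w ^ 1 := by ring
    rw [h0, w2]; linear_combination ((1)) * hw + ((-3) + (1) * w ^ 1) * hp
  have z3 : z ^ 3 = (1) + (1) * z ^ 2 := by
    have h0 : z ^ 3 = z ^ 2 * z ^ 1 := by ring
    rw [h0]; linear_combination ((1)) * hz + ((3) + (3) * z ^ 1 + (-1) * z ^ 2) * hp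
  have z6 : z ^ 6 = (1) * z ^ 1 + (1) * z ^ 2 := by
    have h0 : z ^ 6 = z ^ 3 * z ^ 3 := by ring
    rw [h0, z3]; linear_combination ((-1) + (1) * z ^ 1) * hz + ((-3) + (4) * z ^ 2) * hp
  have z7 : z ^ 7 = (1) := by
    have h0 : z ^ 7 = z ^ 6 * z ^ 1 := by ring
    rw [h0, z6]; linear_combination ((1)) * hz + ((3) + (3) * z ^ 1) * hp
  have h3 := ord_dvd (y := w) (n := 3) (by norm_num) w3 (by
    rintro rfl
    exact one_ne_zero (α := k) (by linear_combination hw - 2 * hp))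
  have h7 := ord_dvd (y := z) (n := 7) (by norm_num) z7 (by
    rintro rfl
    exact one_ne_zero (α := k) (by linear_combination hz + 6 * hp))
  have h1 : 1 < Nat.card k := Finite.one_lt_card
  rw [hc] at h3 h7 h1
  by_contra hlt
  have hf : f < 6 := by
    by_contra hf
    have : 2 ^ 6 ≤ 2 ^ f := Nat.pow_le_pow_right (by norm_num) (by omega)
    omega
  interval_cases f <;> omega

lemma res3 {w z : k} (hw : w ^ 2 - w + 5 = 0) (hz : z ^ 3 + z ^ 2 - 6 * z - 7 = 0) {f : ℕ}
    (hc : Nat.card k = 3 ^ f) (hp : (3 : k) = 0) : 50 < 3 ^ f := by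
  have w2 : w ^ 2 = (1) + (1) * w ^ 1 := by
    have h0 : w ^ 2 = w ^ 1 * w ^ 1 := by ring
    rw [h0]; linear_combination ((1)) * hw + ((-2)) * hp
  have w4 : w ^ 4 = (-1) := by
    have h0 : w ^ 4 = w ^ 2 * w ^ 2 := by ring
    rw [h0, w2]; linear_combination ((1)) * hw + ((-1) + (1) * w ^ 1) * hp
  have w8 : w ^ 8 = (1) := by
    have h0 : w ^ 8 = w ^ 4 * w ^ 4 := by ring
    rw [h0, w4]; linear_combination (0) * hw + (0) * hp
  have z3 : z ^ 3 = (1) + (-1) * z ^ 2 := by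
    have h0 : z ^ 3 = z ^ 2 * z ^ 1 := by ring
    rw [h0]; linear_combination ((1)) * hz + ((2) + (2) * z ^ 1) * hp
  have z6 : z ^ 6 = (1) * z ^ 1 + (-1) * z ^ 2 := by
    have h0 : z ^ 6 = z ^ 3 * z ^ 3 := by ring
    rw [h0, z3]; linear_combination ((-1) + (1) * z ^ 1) * hz + ((-2) + (2) * z ^ 2) * hp
  have z12 : z ^ 12 = (1) * z ^ 1 + (1) * z ^ 2 := by
    have h0 : z ^ 12 = z ^ 6 * z ^ 6 := by ring
    rw [h0, z6]; linear_combination ((-3) + (1) * z ^ 1) * hz + ((-7) + (-4) * z ^ 1 + (3) * z ^ 2) * hp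
  have z13 : z ^ 13 = (1) := by
    have h0 : z ^ 13 = z ^ 12 * z ^ 1 := by ring
    rw [h0, z12]; linear_combination ((1)) * hz + ((2) + (2) * z ^ 1) * hp
  have h13 := ord_dvd (y := z) (n := 13) (by norm_num) z13 (by
    rintro rfl
    exact one_ne_zero (α := k) (by linear_combination hz + 4 * hp))
  have hw0 : w ≠ 0 := by
    rintro rfl
    exact one_ne_zero (α := k) (by linear_combination -hw + 2 * hp)
  have h1 : 1 < Nat.card k := Finite.one_lt_card
  have hF : w ^ (Nat.card k - 1) = 1 := by
    have := Fintype.ofFinite k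
    rw [Nat.card_eq_fintype_card]
    exact FiniteField.pow_card_sub_one_eq_one w hw0
  rw [hc] at h13 h1 hF
  by_contra hlt
  have hf : f < 4 := by
    by_contra hf
    have : 3 ^ 4 ≤ 3 ^ f := Nat.pow_le_pow_right (by norm_num) (by omega)
    omega
  interval_cases f
  · omega
  · omega
  · omega
  · norm_num at hF
    have h26 : w ^ 26 = (w ^ 8) ^ 3 * w ^ 2 := by ring
    rw [h26, w8, w2] at hF
    exact hw0 (by linear_combination hF)

lemma res5 {z : k} (hz : z ^ 3 + z ^ 2 - 6 * z - 7 = 0) {f : ℕ}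
    (hc : Nat.card k = 5 ^ f) (hp : (5 : k) = 0) : 50 < 5 ^ f := by
  have z4 : z ^ 4 = (-2) + (1) * z ^ 1 + (2) * z ^ 2 := by
    have h0 : z ^ 4 = z ^ 2 * z ^ 2 := by ring
    rw [h0]; linear_combination ((-1) + (1) * z ^ 1) * hz + ((-1) + (1) * z ^ 2) * hp
  have z8 : z ^ 8 = (-1) + (-1) * z ^ 1 + (2) * z ^ 2 := by
    have h0 : z ^ 8 = z ^ 4 * z ^ 4 := by ring
    rw [h0, z4]; linear_combination ((4) * z ^ 1) * hz + ((1) + (5) * z ^ 1 + (3) * z ^ 2) * hp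
  have z16 : z ^ 16 = (2) * z ^ 1 + (-1) * z ^ 2 := by
    have h0 : z ^ 16 = z ^ 8 * z ^ 8 := by ring
    rw [h0, z8]; linear_combination ((-8) + (4) * z ^ 1) * hz + ((-11) + (-4) * z ^ 1 + (6) * z ^ 2) * hp
  have z24 : z ^ 24 = (-1) + (1) * z ^ 1 := by
    have h0 : z ^ 24 = z ^ 16 * z ^ 8 := by ring
    rw [h0, z16, z8]; linear_combination ((7) + (-2) * z ^ 1) * hz + ((10) + (5) * z ^ 1 + (-4) * z ^ 2) * hp
  have z28 : z ^ 28 = (1) + (-1) * z ^ 1 + (2) * z ^ 2 := by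
    have h0 : z ^ 28 = z ^ 24 * z ^ 4 := by ring
    rw [h0, z24, z4]; linear_combination ((2)) * hz + ((3) + (2) * z ^ 1 + (-1) * z ^ 2) * hp
  have z30 : z ^ 30 = (-1) + (1) * z ^ 1 + (1) * z ^ 2 := by
    have h0 : z ^ 30 = z ^ 28 * z ^ 2 := by ring
    rw [h0, z28]; linear_combination ((-3) + (2) * z ^ 1) * hz + ((-4) + (-1) * z ^ 1 + (3) * z ^ 2) * hp
  have z31 : z ^ 31 = (2) := by
    have h0 : z ^ 31 = z ^ 30 * z ^ 1 := by ring
    rw [h0, z30]; linear_combination ((1)) * hz + ((1) + (1) * z ^ 1) * hp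
  have z62 : z ^ 62 = (-1) := by
    have h0 : z ^ 62 = z ^ 31 * z ^ 31 := by ring
    rw [h0, z31]; linear_combination (0) * hz + ((1)) * hp
  have z124 : z ^ 124 = (1) := by
    have h0 : z ^ 124 = z ^ 62 * z ^ 62 := by ring
    rw [h0, z62]; linear_combination (0) * hz + (0) * hp
  have h31 := ord_dvd (y := z ^ 4) (n := 31) (by norm_num) (by rw [← pow_mul]; exact z124) (by
    intro h
    have h28 : z ^ 28 = (z ^ 4) ^ 7 := by ring
    have h24 : z ^ 24 = (z ^ 4) ^ 6 := by ring
    rw [h] at h28 h24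
    have e1 : z = 2 := by linear_combination -z24 + h24
    rw [e1] at hz
    exact one_ne_zero (α := k) (by linear_combination 2 * hz + 3 * hp))
  have h1 : 1 < Nat.card k := Finite.one_lt_card
  rw [hc] at h31 h1
  by_contra hlt
  have hf : f < 3 := by
    by_contra hf
    have : 5 ^ 3 ≤ 5 ^ f := Nat.pow_le_pow_right (by norm_num) (by omega)
    omega
  interval_cases f <;> omega

lemma resbig {p : ℕ} (hpp : p.Prime) (h7 : 7 < p) {w z : k} (hw : w ^ 2 - w + 5 = 0)
    (hz : z ^ 3 + z ^ 2 - 6 * z - 7 = 0)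
    (hno : (∀ w : ZMod p, w ^ 2 - w + 5 ≠ 0) ∨ (∀ z : ZMod p, z ^ 3 + z ^ 2 - 6 * z - 7 ≠ 0)) {f : ℕ}
    (hc : Nat.card k = p ^ f) : 50 < p ^ f := by
  by_contra hlt
  have h1 : 1 < Nat.card k := Finite.one_lt_card
  have hf : f < 2 := by
    by_contra hf
    have : p ^ 2 ≤ p ^ f := Nat.pow_le_pow_right (by omega) (by omega)
    nlinarith
  have hf1 : f = 1 := by
    interval_cases f
    · simp only [pow_zero] at hc
      omega
    · rfl
  subst hf1
  have := Fintype.ofFinite k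
  rw [pow_one, Nat.card_eq_fintype_card] at hc
  let e := (ZMod.ringEquivOfPrime k hpp hc).symm
  rcases hno with h | h
  · apply h (e w)
    have := congrArg e hw
    simpa [map_ofNat e 5] using this
  · apply h (e z)
    have := congrArg e hz
    simpa [map_ofNat e 6, map_ofNat e 7] using this

end finite
end Stmt6

namespace Stmt6

variable {K : Type*} [Field K] [NumberField K]

lemma rel_l {a l : 𝓞 K} (ha : a ^ 3 + a ^ 2 - 6 * a - 7 = 0) (hl : l ^ 2 = a * l - (a ^ 2 - a - 2)) :
    (l - 3) ^ 6 + (19 : ℤ) * (l - 3) ^ 5 + (152 : ℤ) * (l - 3) ^ 4 + (646 : ℤ) * (l - 3) ^ 3 +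
      (1520 : ℤ) * (l - 3) ^ 2 + (1862 : ℤ) * (l - 3) + (931 : ℤ) = 0 := by
  push_cast
  linear_combination ((7) + (-6) * l ^ 1 + (4) * l ^ 2 + (1) * l ^ 3 + (1) * l ^ 4 + (2) * a ^ 1 + (7) * a ^ 1 * l ^ 1 + (2) * a ^ 1 * l ^ 2 + (1) * a ^ 1 * l ^ 3 + (5) * a ^ 2 + (2) * a ^ 2 * l ^ 1 + (-1) * a ^ 3 * l ^ 1 + (-1) * a ^ 4) * hl + ((-3) + (1) * l ^ 1 + (1) * a ^ 1 + (-3) * a ^ 1 * l ^ 1 + (-2) * a ^ 2 + (1) * a ^ 3) * ha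

lemma rel_t {a l : 𝓞 K} (ha : a ^ 3 + a ^ 2 - 6 * a - 7 = 0) (hl : l ^ 2 = a * l - (a ^ 2 - a - 2)) :
    (2 * l - a) ^ 6 + (0 : ℤ) * (2 * l - a) ^ 5 + (19 : ℤ) * (2 * l - a) ^ 4 +
      (0 : ℤ) * (2 * l - a) ^ 3 + (38 : ℤ) * (2 * l - a) ^ 2 + (0 : ℤ) * (2 * l - a) + (19 : ℤ) = 0 := by
  push_cast
  linear_combination ((1016) + (432) * l ^ 2 + (64) * l ^ 4 + (560) * a ^ 1 + (-432) * a ^ 1 * l ^ 1 + (64) * a ^ 1 * l ^ 2 + (-128) * a ^ 1 * l ^ 3 + (-248) * a ^ 2 + (-64) * a ^ 2 * l ^ 1 + (48) * a ^ 2 * l ^ 2 + (-80) * a ^ 3 + (16) * a ^ 3 * l ^ 1 + (28) * a ^ 4) * hl + ((-293) + (-54) * a ^ 1 + (135) * a ^ 2 + (-27) * a ^ 3) * ha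

lemma rel_b {a l : 𝓞 K} (ha : a ^ 3 + a ^ 2 - 6 * a - 7 = 0) (hl : l ^ 2 = a * l - (a ^ 2 - a - 2)) :
    (7 + 2 * a + 8 * l - 2 * a * l - 2 * a ^ 2 * l) ^ 2 = -19 := by
  linear_combination ((64) + (-32) * a ^ 1 + (-28) * a ^ 2 + (8) * a ^ 3 + (4) * a ^ 4) * hl + ((-28) + (-16) * l ^ 1 + (20) * a ^ 1 + (4) * a ^ 1 * l ^ 1 + (4) * a ^ 2 * l ^ 1 + (-4) * a ^ 3) * ha

lemma irr_l : Irreducible (sx 19 152 646 1520 1862 931) := by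
  apply sx_irred <;> decide

lemma irr_t : Irreducible (sx 0 19 0 38 0 19) := by
  apply sx_irred <;> decide

lemma norm_t (hdeg : Module.finrank ℚ K = 6) {a l : 𝓞 K} (ha : a ^ 3 + a ^ 2 - 6 * a - 7 = 0)
    (hl : l ^ 2 = a * l - (a ^ 2 - a - 2)) : Ideal.absNorm (Ideal.span {2 * l - a}) = 19 := by
  have := sx_norm hdeg irr_t (rel_t ha hl) 0
  simpa using this

lemma norm_l (hdeg : Module.finrank ℚ K = 6) {a l : 𝓞 K} (ha : a ^ 3 + a ^ 2 - 6 * a - 7 = 0)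
    (hl : l ^ 2 = a * l - (a ^ 2 - a - 2)) : Ideal.absNorm (Ideal.span {l}) = 7 := by
  have := sx_norm hdeg irr_l (rel_l ha hl) (-3)
  have h2 : l - 3 - ((-3 : ℤ) : 𝓞 K) = l := by push_cast; ring
  rw [h2] at this
  rw [this]; rfl

lemma norm_l1 (hdeg : Module.finrank ℚ K = 6) {a l : 𝓞 K} (ha : a ^ 3 + a ^ 2 - 6 * a - 7 = 0)
    (hl : l ^ 2 = a * l - (a ^ 2 - a - 2)) : Ideal.absNorm (Ideal.span {l + 1}) = 11 := by
  have := sx_norm hdeg irr_l (rel_l ha hl) (-4)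
  have h2 : l - 3 - ((-4 : ℤ) : 𝓞 K) = l + 1 := by push_cast; ring
  rw [h2] at this
  rw [this]; rfl

lemma discr_le (hdeg : Module.finrank ℚ K = 6) {a l : 𝓞 K} (ha : a ^ 3 + a ^ 2 - 6 * a - 7 = 0)
    (hl : l ^ 2 = a * l - (a ^ 2 - a - 2)) : |discr K| ≤ 19 ^ 5 := by
  have hl' : (a - l) ^ 2 = a * (a - l) - (a ^ 2 - a - 2) := by linear_combination hl
  have d1 := sx_diff hdeg irr_l (rel_l ha hl)
  have d2 := sx_diff hdeg irr_l (rel_l ha hl')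
  have hmem : (2 * l - a) ^ 5 ∈ differentIdeal ℤ (𝓞 K) := by
    have := Ideal.add_mem _ (Ideal.mul_mem_left _ (-2 - a + 2 * a * l) d1)
      (Ideal.mul_mem_left _ (2 + a - 2 * a ^ 2 + 2 * a * l) d2)
    convert this using 1
    push_cast
    linear_combination ((144) * l ^ 1 + (56) * l ^ 3 + (-72) * a ^ 1 + (192) * a ^ 1 * l ^ 1 + (-84) * a ^ 1 * l ^ 2 + (-8) * a ^ 1 * l ^ 3 + (-96) * a ^ 2 + (-136) * a ^ 2 * l ^ 1 + (12) * a ^ 2 * l ^ 2 + (-72) * a ^ 2 * l ^ 3 + (82) * a ^ 3 + (-92) * a ^ 3 * l ^ 1 + (108) * a ^ 3 * l ^ 2 + (44) * a ^ 4 + (-60) * a ^ 4 * l ^ 1 + (12) * a ^ 5) * hl + ((-40) * l ^ 1 + (20) * a ^ 1 + (-24) * a ^ 1 * l ^ 1 + (12) * a ^ 2 + (56) * a ^ 2 * l ^ 1 + (-28) * a ^ 3) * ha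
  have h1 := Ideal.absNorm_dvd_absNorm_of_le ((Ideal.span_singleton_le_iff_mem _).mpr hmem)
  rw [← Ideal.span_singleton_pow, map_pow, norm_t hdeg ha hl, absNorm_differentIdeal K] at h1
  have h2 := Nat.le_of_dvd (by norm_num) h1
  rw [Int.abs_eq_natAbs]
  exact_mod_cast h2

lemma totC {b : K} (hb : b ^ 2 = -19) : IsTotallyComplex K := by
  refine ⟨fun v => ?_⟩
  rw [← InfinitePlace.not_isReal_iff_isComplex]
  intro hv
  have h : (InfinitePlace.embedding_of_isReal hv b) ^ 2 = -19 := by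
    rw [← map_pow, hb]; simp [map_ofNat]
  nlinarith [sq_nonneg (InfinitePlace.embedding_of_isReal hv b)]

lemma minkowski (hdeg : Module.finrank ℚ K = 6) {a l : 𝓞 K} (ha : a ^ 3 + a ^ 2 - 6 * a - 7 = 0)
    (hl : l ^ 2 = a * l - (a ^ 2 - a - 2)) :
    ⌊(4 / Real.pi) ^ InfinitePlace.nrComplexPlaces K *
              (↑(Module.finrank ℚ K).factorial / ↑(Module.finrank ℚ K) ^ Module.finrank ℚ K *
                √|((discr K : ℤ) : ℝ)|)⌋₊ ≤ 50 := by
  have hb := congrArg (algebraMap (𝓞 K) K) (rel_b ha hl)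
  have : IsTotallyComplex K := by
    apply totC (b := algebraMap (𝓞 K) K (7 + 2 * a + 8 * l - 2 * a * l - 2 * a ^ 2 * l))
    rw [← map_pow, hb, map_neg, map_ofNat (algebraMap (𝓞 K) K) 19]
  have hr := IsTotallyComplex.nrRealPlaces_eq_zero K
  have hc := InfinitePlace.card_add_two_mul_card_eq_rank K
  have hc3 : InfinitePlace.nrComplexPlaces K = 3 := by omega
  have hd := discr_le hdeg ha hl
  have hd' : |((discr K : ℤ) : ℝ)| ≤ 1574 ^ 2 := by
    have : ((|discr K| : ℤ) : ℝ) ≤ ((19 ^ 5 : ℤ) : ℝ) := by exact_mod_cast hd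
    push_cast at this
    linarith
  have hs : √|((discr K : ℤ) : ℝ)| ≤ 1574 := by
    rw [Real.sqrt_le_left (by norm_num)]
    exact hd'
  have hpi : 4 / Real.pi ≤ 4 / 3.14 := by
    apply div_le_div_of_nonneg_left <;> linarith [Real.pi_gt_d2]
  have hpi0 : 0 ≤ 4 / Real.pi := by positivity
  rw [hc3, hdeg]
  have hlt : (4 / Real.pi) ^ 3 * (((Nat.factorial 6 : ℕ) : ℝ) / ((6 : ℕ) : ℝ) ^ 6 *
                √|((discr K : ℤ) : ℝ)|) < 51 := by
    calc _ ≤ (4 / 3.14 : ℝ) ^ 3 * (((Nat.factorial 6 : ℕ) : ℝ) / ((6 : ℕ) : ℝ) ^ 6 * 1574) := by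
          gcongr
      _ < 51 := by norm_num [Nat.factorial]
  exact Nat.lt_succ_iff.mp ((Nat.floor_lt' (by norm_num)).mpr (lt_of_lt_of_eq hlt (by norm_num)))

lemma principal_over {x : 𝓞 K} {p : ℕ} (hp : p.Prime) (hx : Ideal.absNorm (Ideal.span {x}) = p) :
    Ideal.span {x} ∈ (Ideal.span {(p : ℤ)}).primesOver (𝓞 K) := by
  have hpr : (Ideal.span {x}).IsPrime := by
    apply Ideal.isPrime_of_irreducible_absNorm
    rw [hx]; exact hp
  refine ⟨hpr, ⟨?_⟩⟩
  have hmax : (Ideal.span {(p : ℤ)}).IsMaximal := by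
    apply PrincipalIdealRing.isMaximal_of_irreducible
    exact (Nat.prime_iff_prime_int.mp hp).irreducible
  apply hmax.eq_of_le
  · exact (Ideal.IsPrime.under ℤ _).ne_top
  · rw [Ideal.span_singleton_le_iff_mem, Ideal.mem_comap]
    have := Ideal.absNorm_mem (Ideal.span {x})
    rw [hx] at this
    simpa using this

lemma inert_over {a w : 𝓞 K} (ha : a ^ 3 + a ^ 2 - 6 * a - 7 = 0) (hw : w ^ 2 - w + 5 = 0)
    {p : ℕ} (hp : p.Prime) {M : ℕ} (hM : M ≤ 50)
    (hcase : p = 2 ∨ p = 3 ∨ p = 5 ∨ (7 < p ∧ ((∀ w : ZMod p, w ^ 2 - w + 5 ≠ 0) ∨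
      (∀ z : ZMod p, z ^ 3 + z ^ 2 - 6 * z - 7 ≠ 0)))) :
    ∃ P ∈ (Ideal.span {(p : ℤ)}).primesOver (𝓞 K), M < p ^ P.inertiaDeg ℤ ∨
      Submodule.IsPrincipal P := by
  have hpi := Nat.prime_iff_prime_int.mp hp
  have hprime : (Ideal.span {(p : ℤ)}).IsPrime := (Ideal.span_singleton_prime hpi.ne_zero).mpr hpi
  obtain ⟨P, hP⟩ := Ideal.nonempty_primesOver (S := 𝓞 K) (Ideal.span {(p : ℤ)})
  refine ⟨P, hP, Or.inl (hM.trans_lt ?_)⟩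
  have h1 : P.IsPrime := hP.1
  have h2 : P.LiesOver (Ideal.span {(p : ℤ)}) := hP.2
  have hne : P ≠ ⊥ := by
    apply Ideal.ne_bot_of_liesOver_of_ne_bot (p := Ideal.span {(p : ℤ)})
    simpa using hpi.ne_zero
  have hmx : P.IsMaximal := h1.isMaximal hne
  have hcard := Ideal.natAbs_pow_inertiaDeg (p : ℤ) P
  rw [Int.natAbs_natCast, Ideal.absNorm_apply, Submodule.cardQuot_apply] at hcard
  letI : Field (𝓞 K ⧸ P) := Ideal.Quotient.field P
  have hfin : Finite (𝓞 K ⧸ P) := Ideal.finiteQuotientOfFreeOfNeBot P hne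
  let q : 𝓞 K →+* 𝓞 K ⧸ P := Ideal.Quotient.mk P
  have hw' : (q w) ^ 2 - q w + 5 = 0 := by
    have := congrArg q hw
    simpa [map_ofNat q 5] using this
  have ha' : (q a) ^ 3 + q a ^ 2 - 6 * q a - 7 = 0 := by
    have := congrArg q ha
    simpa [map_ofNat q 6, map_ofNat q 7] using this
  have hpz : (p : 𝓞 K ⧸ P) = 0 := by
    have hm : (p : ℤ) ∈ Ideal.under ℤ P := by
      rw [← h2.over]; exact Ideal.mem_span_singleton_self _
    rw [Ideal.mem_comap] at hm
    have := Ideal.Quotient.eq_zero_iff_mem.mpr hm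
    simpa using this
  rcases hcase with rfl | rfl | rfl | ⟨h7, hno⟩
  · exact res2 hw' ha' hcard.symm (by exact_mod_cast hpz)
  · exact res3 hw' ha' hcard.symm (by exact_mod_cast hpz)
  · exact res5 ha' hcard.symm (by exact_mod_cast hpz)
  · exact resbig hp h7 hw' ha' hno hcard.symm

lemma rel_w {a l : 𝓞 K} (ha : a ^ 3 + a ^ 2 - 6 * a - 7 = 0) (hl : l ^ 2 = a * l - (a ^ 2 - a - 2)) :
    (4 + a + 4 * l - a * l - a ^ 2 * l) ^ 2 - (4 + a + 4 * l - a * l - a ^ 2 * l) + 5 = 0 := by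
  linear_combination (16 - 8 * a - 7 * a ^ 2 + 2 * a ^ 3 + a ^ 4) * hl + (-7 - 4 * l + 5 * a + a * l + a ^ 2 * l - a ^ 3) * ha

theorem pid (hdeg : Module.finrank ℚ K = 6) [IsGalois ℚ K] {a l : 𝓞 K}
    (ha : a ^ 3 + a ^ 2 - 6 * a - 7 = 0)
    (hl : l ^ 2 = a * l - (a ^ 2 - a - 2)) : IsPrincipalIdealRing (𝓞 K) := by
  apply RingOfIntegers.isPrincipalIdealRing_of_isPrincipal_of_lt_or_isPrincipal_of_mem_primesOver_of_mem_Icc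
  have hM := minkowski hdeg ha hl
  generalize ⌊(4 / Real.pi) ^ InfinitePlace.nrComplexPlaces K *
              (↑(Module.finrank ℚ K).factorial / ↑(Module.finrank ℚ K) ^ Module.finrank ℚ K *
                √|((discr K : ℤ) : ℝ)|)⌋₊ = M at hM ⊢
  intro p hpM hp
  have hp50 : p ≤ 50 := (Finset.mem_Icc.mp hpM).2.trans hM
  have hw := rel_w ha hl
  by_cases h7 : p = 7
  · subst h7
    exact ⟨_, principal_over hp (norm_l hdeg ha hl), Or.inr ⟨_, rfl⟩⟩
  by_cases h11 : p = 11
  · subst h11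
    exact ⟨_, principal_over hp (norm_l1 hdeg ha hl), Or.inr ⟨_, rfl⟩⟩
  by_cases h19 : p = 19
  · subst h19
    exact ⟨_, principal_over hp (norm_t hdeg ha hl), Or.inr ⟨_, rfl⟩⟩
  apply inert_over ha hw hp hM
  clear hpM
  interval_cases p
  all_goals first
    | (exfalso; revert hp; norm_num; done)
    | omega
    | (exact Or.inr (Or.inr (Or.inr ⟨by norm_num, Or.inl (by decide)⟩)))
    | (exact Or.inr (Or.inr (Or.inr ⟨by norm_num, Or.inr (by decide)⟩)))

end Stmt6

namespace Stmt6

/-- Shorthand for the action of a Galois automorphism on the ring of integers. -/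
noncomputable abbrev gr {K : Type*} [Field K] [NumberField K] (τ : K ≃ₐ[ℚ] K) :
    𝓞 K ≃ₐ[ℤ] 𝓞 K := galRestrict ℤ ℚ K (𝓞 K) τ

/-- The data used to build the character. -/
structure Dat {K : Type*} [Field K] [NumberField K] (σ : K ≃ₐ[ℚ] K) (r : 𝓞 K →+* ZMod 19) (w : 𝓞 K) :
    Prop where
  hdeg : Module.finrank ℚ K = 6
  gal : IsGalois ℚ K
  gen : ∀ τ : K ≃ₐ[ℚ] K, τ ∈ Subgroup.zpowers σ
  ord : orderOf σ = 6
  conj : ∀ (φ : K →+* ℂ) (x : K), φ ((σ ^ 3) x) = starRingEnd ℂ (φ x)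
  red : ∀ (x : 𝓞 K), r (gr σ x) = r x
  hw : w ^ 2 - w + 5 = 0
  hw3 : gr (σ ^ 3) w = 1 - w
  prin : IsPrincipalIdealRing (𝓞 K)

variable {K : Type*} [Field K] [NumberField K] {σ : K ≃ₐ[ℚ] K} {r : 𝓞 K →+* ZMod 19} {w : 𝓞 K}

instance fact19 : Fact (Nat.Prime 19) := ⟨by norm_num⟩

lemma gr_coe (τ : K ≃ₐ[ℚ] K) (x : 𝓞 K) : ((gr τ x : 𝓞 K) : K) = τ x :=
  algebraMap_galRestrict_apply ℤ τ x

lemma gr_mul (τ υ : K ≃ₐ[ℚ] K) (x : 𝓞 K) : gr (τ * υ) x = gr τ (gr υ x) := by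
  apply RingOfIntegers.ext
  simp only [gr_coe]; rfl

lemma gr_one (x : 𝓞 K) : gr (1 : K ≃ₐ[ℚ] K) x = x := by
  apply RingOfIntegers.ext
  simp only [gr_coe]; rfl

lemma Dat.six (D : Dat σ r w) : σ ^ 6 = 1 := by rw [← D.ord]; exact pow_orderOf_eq_one σ

lemma Dat.redp (D : Dat σ r w) (n : ℕ) (x : 𝓞 K) : r (gr (σ ^ n) x) = r x := by
  induction n with
  | zero => rw [pow_zero, gr_one]
  | succ n ih => rw [pow_succ', gr_mul, D.red, ih]

lemma Dat.fixed (D : Dat σ r w) (x : 𝓞 K) (hx : gr σ x = x) : ∃ n : ℤ, (n : 𝓞 K) = x := by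
  have := D.gal
  have h1 : ∀ τ : K ≃ₐ[ℚ] K, τ (x : K) = x := by
    intro τ
    obtain ⟨k, rfl⟩ := (mem_powers_iff_mem_zpowers (x := σ)).mpr (D.gen τ)
    show (σ ^ k) (x : K) = x
    induction k with
    | zero => rfl
    | succ k ih =>
      rw [pow_succ', AlgEquiv.mul_apply, ih, ← gr_coe, hx]
  have h2 := (IsGalois.mem_bot_iff_fixed (F := ℚ) (x : K)).mpr h1
  obtain ⟨q, hq⟩ := IntermediateField.mem_bot.mp h2
  have h3 : IsIntegral ℤ q := by
    have : IsIntegral ℤ (x : K) := x.isIntegral_coe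
    rw [← hq] at this
    exact (isIntegral_algebraMap_iff (algebraMap ℚ K).injective).mp this
  obtain ⟨n, hn⟩ := IsIntegrallyClosed.isIntegral_iff.mp h3
  refine ⟨n, ?_⟩
  apply RingOfIntegers.ext
  rw [← hq, ← hn]
  simp

lemma Dat.prod (D : Dat σ r w) (x : 𝓞 K) :
    x * gr σ x * gr (σ ^ 2) x * (gr (σ ^ 3) x * gr (σ ^ 4) x * gr (σ ^ 5) x) =
      (Ideal.absNorm (Ideal.span {x}) : 𝓞 K) := by
  have := D.gal
  have h1 := Algebra.norm_eq_prod_automorphisms ℚ (x : K)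
  have h2 : ∏ τ : K ≃ₐ[ℚ] K, τ (x : K) = ∏ i ∈ Finset.range 6, (σ ^ i) (x : K) := by
    symm
    apply Finset.prod_bij (fun i _ => σ ^ i)
    · simp
    · intro i hi j hj h
      rw [pow_inj_mod, D.ord] at h
      simp at hi hj
      rwa [Nat.mod_eq_of_lt hi, Nat.mod_eq_of_lt hj] at h
    · intro τ _
      obtain ⟨k, hk⟩ := (mem_powers_iff_mem_zpowers (x := σ)).mpr (D.gen τ)
      refine ⟨k % 6, by simp [Nat.mod_lt], ?_⟩
      rw [← hk, ← D.ord]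
      exact pow_mod_orderOf σ k
    · intros; rfl
  rw [h2, ← Algebra.coe_norm_int] at h1
  have h3 : ((Algebra.norm ℤ x : ℤ) : K) = (x : K) * σ x * (σ ^ 2) (x : K) * (σ ^ 3) ((x : K) * σ x * (σ ^ 2) (x : K)) := by
    have e4 : (σ ^ 3) (σ (x : K)) = (σ ^ 4) (x : K) := by rw [pow_succ σ 3]; rfl
    have e5 : (σ ^ 3) ((σ ^ 2) (x : K)) = (σ ^ 5) (x : K) := by rw [pow_add σ 3 2]; rfl
    rw [map_mul, map_mul, e4, e5]
    simp only [Finset.prod_range_succ, Finset.prod_range_zero, pow_zero, pow_one, one_mul] at h1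
    rw [← mul_assoc, ← mul_assoc]
    simpa using h1
  have h4 : 0 ≤ Algebra.norm ℤ x := by
    obtain ⟨φ⟩ : Nonempty (K →+* ℂ) := inferInstance
    have h5 := congrArg φ h3
    rw [map_mul, D.conj, Complex.mul_conj, map_intCast] at h5
    have h6 : ((Algebra.norm ℤ x : ℤ) : ℝ) = Complex.normSq (φ ((x : K) * σ x * (σ ^ 2) (x : K))) := by
      exact_mod_cast h5
    have := Complex.normSq_nonneg (φ ((x : K) * σ x * (σ ^ 2) (x : K)))
    rw [← h6] at this
    exact_mod_cast this
  rw [Ideal.absNorm_span_singleton]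
  have h7 : (((Algebra.norm ℤ x).natAbs : ℕ) : 𝓞 K) = ((Algebra.norm ℤ x : ℤ) : 𝓞 K) := by
    rw [← Int.cast_natCast, Int.natAbs_of_nonneg h4]
  rw [h7]
  apply RingOfIntegers.ext
  have e4 : (σ ^ 3) (σ (x : K)) = (σ ^ 4) (x : K) := by rw [pow_succ σ 3]; rfl
  have e5 : (σ ^ 3) ((σ ^ 2) (x : K)) = (σ ^ 5) (x : K) := by rw [pow_add σ 3 2]; rfl
  simp only [map_mul, gr_coe, map_intCast]
  rw [h3, map_mul, map_mul, e4, e5]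

lemma Dat.kron (D : Dat σ r w) (v : 𝓞 K) (hv : ∀ φ : K →+* ℂ, ‖φ v‖ = 1) (h1 : r v = 1) : v = 1 := by
  obtain ⟨n, hn, hvn⟩ := Embeddings.pow_eq_one_of_norm_eq_one K ℂ v.isIntegral_coe hv
  have hvn' : v ^ n = 1 := by
    apply RingOfIntegers.ext
    simpa using hvn
  by_contra hne
  have hm0 : 0 < orderOf v := orderOf_pos_iff.mpr (isOfFinOrder_iff_pow_eq_one.mpr ⟨n, hn, hvn'⟩)
  have hm1 : orderOf v ≠ 1 := by rwa [ne_eq, orderOf_eq_one_iff]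
  obtain ⟨p, hp, hpm⟩ := Nat.exists_prime_and_dvd hm1
  obtain ⟨k, hk⟩ := hpm
  have hprim : IsPrimitiveRoot (v ^ k) p :=
    (IsPrimitiveRoot.orderOf v).pow hm0 (by rw [hk, mul_comm])
  have hs := congrArg r (hprim.geom_sum_eq_zero hp.one_lt)
  simp only [map_sum, map_pow, h1, one_pow, map_zero] at hs
  simp only [Finset.sum_const, Finset.card_range, nsmul_eq_mul, mul_one] at hs
  rw [ZMod.natCast_eq_zero_iff] at hs
  have hp19 : p = 19 := ((Nat.prime_dvd_prime_iff_eq (by norm_num) hp).mp hs).symm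
  subst hp19
  have hprim' : IsPrimitiveRoot (((v ^ k : 𝓞 K)) : K) 19 :=
    hprim.map_of_injective (f := algebraMap (𝓞 K) K) RingOfIntegers.coe_injective
  have h2 := hprim'.totient_le_degree_minpoly
  have h3 : (minpoly ℤ ((v ^ k : 𝓞 K) : K)).natDegree = (minpoly ℚ ((v ^ k : 𝓞 K) : K)).natDegree := by
    rw [minpoly.isIntegrallyClosed_eq_field_fractions' ℚ (v ^ k).isIntegral_coe]
    exact ((minpoly.monic (v ^ k).isIntegral_coe).natDegree_map _).symm
  have h4 := minpoly.natDegree_le (A := ℚ) ((v ^ k : 𝓞 K) : K)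
  rw [D.hdeg, ← h3] at h4
  have h5 : Nat.totient 19 = 18 := by rw [Nat.totient_prime (by norm_num)]
  omega

lemma Dat.assoc (D : Dat σ r w) {s u : 𝓞 K} (hs : r s ≠ 0) (h : gr (σ ^ 3) s = u * s) : gr (σ ^ 3) s = s := by
  have : u = 1 := by
    apply D.kron
    · intro φ
      have h2 : φ ((gr (σ ^ 3) s : 𝓞 K) : K) = φ ((u * s : 𝓞 K) : K) := by rw [h]
      have hm : ((u * s : 𝓞 K) : K) = (u : K) * (s : K) := map_mul (algebraMap (𝓞 K) K) u s
      rw [gr_coe, D.conj, hm, map_mul φ] at h2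
      have h3 := congrArg norm h2
      rw [RCLike.norm_conj, norm_mul] at h3
      have hs0 : s ≠ 0 := by rintro rfl; simp at hs
      have : ‖φ (s : K)‖ ≠ 0 := by simpa using hs0
      exact (mul_right_cancel₀ this ((one_mul _).trans h3)).symm
    · have h2 := congrArg r h
      rw [D.redp, map_mul] at h2
      exact (mul_right_cancel₀ hs ((one_mul _).trans h2)).symm
  rw [h, this, one_mul]

lemma Dat.real (D : Dat σ r w) {s : 𝓞 K} (h : gr (σ ^ 3) s = s) :
    ∃ n : ℤ, s * gr (σ ^ 4) s * gr (σ ^ 5) s = n ∧ n ^ 2 = Ideal.absNorm (Ideal.span {s}) ∧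
      r s ^ 3 = n := by
  have e4 : gr (σ ^ 4) s = gr σ s := by rw [pow_succ', gr_mul, h]
  have e5 : gr (σ ^ 5) s = gr (σ ^ 2) s := by rw [pow_add σ 2 3, gr_mul, h]
  have e2 : gr (σ ^ 2) s = gr σ (gr σ s) := by rw [pow_two, gr_mul]
  have e3 : gr σ (gr (σ ^ 2) s) = s := by rw [← gr_mul, ← pow_succ', h]
  obtain ⟨n, hn⟩ := D.fixed (s * gr σ s * gr (σ ^ 2) s) (by
    rw [map_mul, map_mul, e3, ← e2]; ring)
  refine ⟨n, by rw [e4, e5, hn], ?_, ?_⟩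
  · have := D.prod s
    rw [h, e4, e5, ← hn] at this
    rw [pow_two]
    exact_mod_cast this
  · have := congrArg r hn
    rw [map_mul, map_mul, D.redp, D.red, map_intCast] at this
    rw [this]; ring

/-- The quadratic twist. -/
noncomputable def psi0 (σ : K ≃ₐ[ℚ] K) (r : 𝓞 K →+* ZMod 19) (s : 𝓞 K) : 𝓞 K :=
  ((quadraticChar (ZMod 19) (r s) : ℤ) : 𝓞 K) * (s * gr (σ ^ 4) s * gr (σ ^ 5) s)

lemma psi0_mul (s t : 𝓞 K) : psi0 σ r (s * t) = psi0 σ r s * psi0 σ r t := by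
  simp only [psi0, map_mul]
  push_cast
  ring

lemma qc_cube {x : ZMod 19} (hx : x ≠ 0) : quadraticChar (ZMod 19) x = quadraticChar (ZMod 19) (x ^ 3) := by
  rw [map_pow, pow_succ, quadraticChar_sq_one hx, one_mul]

lemma Dat.psi0_real (D : Dat σ r w) {s : 𝓞 K} (hs : r s ≠ 0) (h : gr (σ ^ 3) s = s) :
    ∃ n : ℤ, psi0 σ r s = ((quadraticChar (ZMod 19) n * n : ℤ) : 𝓞 K) ∧
      n ^ 2 = Ideal.absNorm (Ideal.span {s}) := by
  obtain ⟨n, h1, h2, h3⟩ := D.real h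
  refine ⟨n, ?_, h2⟩
  rw [psi0, h1, qc_cube hs, h3]
  push_cast
  rfl

lemma Dat.psi0_unit (D : Dat σ r w) {u : 𝓞 K} (hu : IsUnit u) : psi0 σ r u = 1 := by
  have hr : r u ≠ 0 := (hu.map r).ne_zero
  have h3 : gr (σ ^ 3) u = u := by
    obtain ⟨u, rfl⟩ := hu
    apply D.assoc hr (u := gr (σ ^ 3) (u : 𝓞 K) * ((u⁻¹ : (𝓞 K)ˣ) : 𝓞 K))
    rw [mul_assoc, Units.inv_mul, mul_one]
  obtain ⟨n, h1, h2⟩ := D.psi0_real hr h3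
  rw [h1]
  have h4 : Ideal.span {u} = ⊤ := Ideal.span_singleton_eq_top.mpr hu
  rw [h4, Ideal.absNorm_top] at h2
  have h5 : n = 1 ∨ n = -1 := by
    exact sq_eq_one_iff.mp (by exact_mod_cast h2)
  have hq : quadraticChar (ZMod 19) (-1) = -1 := by decide
  rcases h5 with rfl | rfl
  · simp
  · push_cast
    rw [hq]; norm_num

lemma Dat.psi0_congr (D : Dat σ r w) {s t : 𝓞 K} (h : Ideal.span {s} = Ideal.span {t}) :
    psi0 σ r s = psi0 σ r t := by
  rw [Ideal.span_singleton_eq_span_singleton] at h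
  obtain ⟨u, rfl⟩ := h
  rw [psi0_mul, D.psi0_unit u.isUnit, mul_one]

lemma conj_span (τ : K ≃ₐ[ℚ] K) (s : 𝓞 K) : idealConj τ (Ideal.span {s}) = Ideal.span {gr τ s} := by
  rw [idealConj, Ideal.map_span, Set.image_singleton]

end Stmt6

namespace Stmt6

lemma inert_char {k : Type*} [CommRing k] [IsDomain k] {p f : ℕ} (hp : p.Prime) [CharP k p]
    {W : k} (hW : W ^ 2 - W + 5 = 0) (hF : W ^ (p ^ f) = 1 - W) (h19 : p ≠ 19) :
    quadraticChar (ZMod 19) ((p ^ f : ℕ) : ZMod 19) = -1 := by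
  have : Fact p.Prime := ⟨hp⟩
  push_cast
  rw [map_pow]
  by_cases h2 : p = 2
  · subst h2
    have e2 : (2 : k) = 0 := by exact_mod_cast CharP.cast_eq_zero k 2
    have hq : quadraticChar (ZMod 19) ((2 : ℕ) : ZMod 19) = -1 := by decide
    rw [hq]
    have key : ∀ f, Even f → W ^ (2 ^ f) = W := by
      intro f hf
      obtain ⟨m, rfl⟩ := hf
      induction m with
      | zero => simp
      | succ m ih =>
        have : 2 ^ (m + 1 + (m + 1)) = 2 ^ (m + m) * 4 := by ring
        rw [this, pow_mul, ih]
        linear_combination (W ^ 2 + W - 4) * hW + (10 - 5 * W) * e2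
    rcases Nat.even_or_odd f with hf | hf
    · rw [key f hf] at hF
      exfalso
      have : (1 : k) = 0 := by linear_combination -hF + W * e2
      exact one_ne_zero this
    · exact hf.neg_one_pow
  · have hodd : Odd p := hp.odd_of_ne_two h2
    have hb : (2 * W - 1) ^ 2 = ((-19 : ℤ) : k) := by
      push_cast
      linear_combination 4 * hW
    set b := 2 * W - 1 with hbdef
    have hne2 : (2 : k) ≠ 0 := by
      intro h
      have h' : ((2 : ℕ) : k) = 0 := by exact_mod_cast h
      rw [CharP.cast_eq_zero_iff k p] at h'
      exact h2 ((Nat.prime_dvd_prime_iff_eq hp Nat.prime_two).mp h')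
    have h19k : ((19 : ℕ) : k) ≠ 0 := by
      intro h'
      rw [CharP.cast_eq_zero_iff k p] at h'
      exact h19 ((Nat.prime_dvd_prime_iff_eq hp (by norm_num)).mp h')
    have hb0 : b ≠ 0 := by
      intro h
      rw [h] at hb
      apply h19k
      push_cast at hb ⊢
      linear_combination hb
    have hbF : b ^ (p ^ f) = -b := by
      have : ExpChar k p := .prime hp
      rw [hbdef, sub_pow_expChar_pow, mul_pow, hF, one_pow]
      have h2f : (2 : k) ^ p ^ f = 2 := by
        have : (((2 : ZMod p) ^ p ^ f : ZMod p)) = 2 := by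
          rw [ZMod.pow_card_pow]
        have h3 := congrArg (ZMod.castHom (dvd_refl p) k) this
        rwa [map_pow, map_ofNat] at h3
      rw [h2f]; ring
    set L := legendreSym p (-19) with hL
    have hLk : ((L : ℤ) : k) = ((-19 : ℤ) : k) ^ (p / 2) := by
      have h3 := congrArg (ZMod.castHom (dvd_refl p) k) (legendreSym.eq_pow p (-19))
      rwa [map_pow, map_intCast, map_intCast] at h3
    have hL1 : L = 1 ∨ L = -1 := by
      apply legendreSym.eq_one_or_neg_one
      intro h
      apply h19k
      have h3 := congrArg (ZMod.castHom (dvd_refl p) k) h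
      rw [map_intCast, map_zero] at h3
      push_cast at h3 ⊢
      linear_combination -h3
    have hbp : b ^ p = L * b := by
      conv_lhs => rw [← Nat.div_add_mod p 2, Nat.odd_iff.mp hodd, pow_add, pow_mul, hb, pow_one, ← hLk]
    have hLp : (L : k) ^ p = L := by
      rcases hL1 with h | h <;> rw [h]
      · simp
      · push_cast; exact hodd.neg_one_pow
    have hbf : ∀ f, b ^ (p ^ f) = (L : k) ^ f * b := by
      intro f
      induction f with
      | zero => simp
      | succ f ih => rw [pow_succ, pow_mul, ih, mul_pow, ← pow_mul, mul_comm f p, pow_mul, hLp, hbp]; ring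
    rw [hbf f] at hbF
    have hLf : (L : k) ^ f = -1 := mul_right_cancel₀ hb0 (by rw [hbF]; ring)
    have hrec : quadraticChar (ZMod 19) ((p : ℕ) : ZMod 19) = L := by
      have e1 : quadraticChar (ZMod 19) ((p : ℕ) : ZMod 19) = legendreSym 19 (p : ℤ) := by
        simp [legendreSym]
      rw [e1, legendreSym.quadratic_reciprocity' h2 (by norm_num), hL]
      have : (-19 : ℤ) = (-1) * ((19 : ℕ) : ℤ) := by norm_num
      rw [this, legendreSym.mul, legendreSym.at_neg_one h2, ZMod.χ₄_eq_neg_one_pow (Nat.odd_iff.mp hodd)]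
      congr 1
      rw [mul_comm, pow_mul]
      norm_num
    rw [hrec]
    rcases hL1 with h | h
    · rw [h] at hLf
      exfalso
      apply hne2
      push_cast at hLf
      rw [one_pow] at hLf
      linear_combination hLf
    · rcases Nat.even_or_odd f with hf | hf
      · rw [h] at hLf
        exfalso
        apply hne2
        push_cast at hLf
        rw [hf.neg_one_pow] at hLf
        linear_combination hLf
      · rw [h]; exact hf.neg_one_pow

end Stmt6

namespace Stmt6
variable {K : Type*} [Field K] [NumberField K] {σ : K ≃ₐ[ℚ] K} {r : 𝓞 K →+* ZMod 19} {w : 𝓞 K}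

lemma fixF (x : 𝓞 (cubicFixedField σ)) :
    gr (σ ^ 3) (algebraMap (𝓞 (cubicFixedField σ)) (𝓞 K) x) = algebraMap _ (𝓞 K) x := by
  apply RingOfIntegers.ext
  rw [gr_coe]
  exact (IntermediateField.mem_fixedField_iff _ _).mp (x : cubicFixedField σ).2 _ (Subgroup.mem_zpowers _)

lemma fixF' {x : 𝓞 K} (hx : gr (σ ^ 3) x = x) :
    ∃ y : 𝓞 (cubicFixedField σ), algebraMap (𝓞 (cubicFixedField σ)) (𝓞 K) y = x := by
  have hm : (x : K) ∈ cubicFixedField σ := by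
    refine (IntermediateField.mem_fixedField_iff _ _).mpr ?_
    intro τ hτ
    have h3 : IsOfFinOrder (σ ^ 3) := isOfFinOrder_of_finite _
    rw [← h3.mem_powers_iff_mem_zpowers] at hτ
    obtain ⟨k, rfl⟩ := hτ
    show ((σ ^ 3) ^ k) (x : K) = x
    induction k with
    | zero => rfl
    | succ k ih => rw [pow_succ', AlgEquiv.mul_apply, ih, ← gr_coe, hx]
  have hi : IsIntegral ℤ (⟨(x : K), hm⟩ : cubicFixedField σ) := by
    have h : IsIntegral ℤ (x : K) := x.isIntegral_coe
    exact (isIntegral_algebraMap_iff (algebraMap (cubicFixedField σ) K).injective).mp h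
  refine ⟨⟨_, hi⟩, ?_⟩
  apply RingOfIntegers.ext
  rfl

lemma invF (𝔭 : Ideal (𝓞 (cubicFixedField σ))) {x : 𝓞 K}
    (hx : x ∈ Ideal.map (algebraMap (𝓞 (cubicFixedField σ)) (𝓞 K)) 𝔭) :
    gr (σ ^ 3) x ∈ Ideal.map (algebraMap (𝓞 (cubicFixedField σ)) (𝓞 K)) 𝔭 := by
  have : Ideal.map (algebraMap (𝓞 (cubicFixedField σ)) (𝓞 K)) 𝔭 ≤
      Ideal.comap (gr (σ ^ 3)) (Ideal.map (algebraMap (𝓞 (cubicFixedField σ)) (𝓞 K)) 𝔭) := by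
    rw [Ideal.map_le_iff_le_comap]
    intro y hy
    rw [Ideal.mem_comap, Ideal.mem_comap, fixF]
    exact Ideal.mem_map_of_mem _ hy
  exact this hx

lemma Dat.rank (D : Dat σ r w) : Module.finrank (cubicFixedField σ) K = 2 := by
  rw [cubicFixedField, IntermediateField.finrank_fixedField_eq_card, Nat.card_zpowers,
    orderOf_pow' σ (by norm_num), D.ord]
  norm_num

lemma Dat.normF (D : Dat σ r w) (𝔭 : Ideal (𝓞 (cubicFixedField σ))) :
    Ideal.absNorm (Ideal.map (algebraMap (𝓞 (cubicFixedField σ)) (𝓞 K)) 𝔭) =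
      Nat.card (𝓞 (cubicFixedField σ) ⧸ 𝔭) ^ 2 := by
  rw [Ideal.absNorm_algebraMap, ← IsFractionRing.finrank_eq (𝓞 (cubicFixedField σ)) (cubicFixedField σ) (𝓞 K) K,
    D.rank, Ideal.absNorm_apply, Submodule.cardQuot_apply]

lemma under_eq {𝔭 : Ideal (𝓞 (cubicFixedField σ))} (hp : 𝔭.IsPrime) (h0 : 𝔭 ≠ ⊥) {Q : Ideal (𝓞 K)}
    (hQ : Q.IsPrime) (hle : Ideal.map (algebraMap (𝓞 (cubicFixedField σ)) (𝓞 K)) 𝔭 ≤ Q) :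
    Q.under (𝓞 (cubicFixedField σ)) = 𝔭 := by
  have hm : 𝔭.IsMaximal := hp.isMaximal h0
  refine (hm.eq_of_le (Ideal.IsPrime.ne_top inferInstance) ?_).symm
  exact Ideal.map_le_iff_le_comap.mp hle

lemma card_le_of_pow {k : Type*} [CommRing k] [IsDomain k] [Finite k] {q : ℕ} (hq1 : 1 < q)
    (hroot : ∀ y : k, y ^ q - y = 0) : Nat.card k ≤ q := by
  have := Fintype.ofFinite k
  have hcard : (Polynomial.X ^ q - Polynomial.X : Polynomial k).natDegree = q := by
    rw [Polynomial.natDegree_sub_eq_left_of_natDegree_lt] <;> simp [hq1]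
  have hne : (Polynomial.X ^ q - Polynomial.X : Polynomial k) ≠ 0 := by
    intro h
    rw [h] at hcard
    simp at hcard
    omega
  have hle := Polynomial.card_le_degree_of_subset_roots
    (p := (Polynomial.X ^ q - Polynomial.X : Polynomial k)) (Z := Finset.univ) (by
      intro y _
      rw [Polynomial.mem_roots hne]
      simp [hroot])
  rwa [hcard, Finset.card_univ, ← Nat.card_eq_fintype_card] at hle

lemma Dat.frob (D : Dat σ r w) {𝔭 : Ideal (𝓞 (cubicFixedField σ))} (hp : 𝔭.IsPrime) (h0 : 𝔭 ≠ ⊥)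
    (hP : (Ideal.map (algebraMap (𝓞 (cubicFixedField σ)) (𝓞 K)) 𝔭).IsPrime) (x : 𝓞 K) :
    gr (σ ^ 3) x - x ^ Nat.card (𝓞 (cubicFixedField σ) ⧸ 𝔭) ∈
      Ideal.map (algebraMap (𝓞 (cubicFixedField σ)) (𝓞 K)) 𝔭 := by
  have := D.gal
  have hnorm := D.normF 𝔭
  have hu := under_eq hp h0 hP le_rfl
  set P := Ideal.map (algebraMap (𝓞 (cubicFixedField σ)) (𝓞 K)) 𝔭 with hPdef
  have hP0 : P ≠ ⊥ := by
    rw [hPdef, ne_eq, Ideal.map_eq_bot_iff_of_injective]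
    · exact h0
    · exact FaithfulSMul.algebraMap_injective _ _
  have hfin : Finite (𝓞 K ⧸ P) := Ideal.finiteQuotientOfFreeOfNeBot P hP0
  have hfin' : Finite (𝓞 (cubicFixedField σ) ⧸ 𝔭) := Ideal.finiteQuotientOfFreeOfNeBot 𝔭 h0
  obtain ⟨τ, hτ⟩ := IsArithFrobAt.exists_of_isInvariant (𝓞 (cubicFixedField σ))
    (K ≃ₐ[cubicFixedField σ] K) P
  have hτ' : ∀ x : 𝓞 K, τ • x - x ^ Nat.card (𝓞 (cubicFixedField σ) ⧸ 𝔭) ∈ P := by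
    intro x
    have := hτ x
    rwa [hu] at this
  have hτK : ∀ x : 𝓞 K, ((τ • x : 𝓞 K) : K) = τ x := fun x => rfl
  have hmem : τ.restrictScalars ℚ ∈ Subgroup.zpowers (σ ^ 3) := by
    have h := IntermediateField.fixingSubgroup_fixedField (Subgroup.zpowers (σ ^ 3))
    rw [← h]
    rintro ⟨y, hy⟩
    exact τ.commutes ⟨y, hy⟩
  have h3 : orderOf (σ ^ 3) = 2 := by
    rw [orderOf_pow' σ (by norm_num), D.ord]; norm_num
  have h33 : (σ ^ 3) ^ 2 = 1 := by rw [← h3]; exact pow_orderOf_eq_one _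
  have hcase : τ.restrictScalars ℚ = 1 ∨ τ.restrictScalars ℚ = σ ^ 3 := by
    have h3' : IsOfFinOrder (σ ^ 3) := isOfFinOrder_of_finite _
    rw [← h3'.mem_powers_iff_mem_zpowers] at hmem
    obtain ⟨k, hk⟩ := hmem
    have hk : (σ ^ 3) ^ k = τ.restrictScalars ℚ := hk
    rw [← pow_mod_orderOf, h3] at hk
    rcases Nat.mod_two_eq_zero_or_one k with h | h <;> rw [h] at hk
    · left; rw [← hk, pow_zero]
    · right; rw [← hk, pow_one]
  rcases hcase with h | h
  · exfalso
    have hx : ∀ x : 𝓞 K, τ • x = x := by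
      intro x
      apply RingOfIntegers.ext
      rw [hτK]
      exact DFunLike.congr_fun h (x : K)
    set q := Nat.card (𝓞 (cubicFixedField σ) ⧸ 𝔭) with hq
    have hq1 : 1 < q := by
      have : Nontrivial (𝓞 (cubicFixedField σ) ⧸ 𝔭) := Ideal.Quotient.nontrivial_iff.mpr hp.ne_top
      exact Finite.one_lt_card
    have hroot : ∀ y : 𝓞 K ⧸ P, y ^ q - y = 0 := by
      intro y
      obtain ⟨x, rfl⟩ := Ideal.Quotient.mk_surjective y
      have := hτ' x
      rw [hx, ← Ideal.Quotient.eq_zero_iff_mem, map_sub, map_pow] at this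
      linear_combination -this
    have hle := card_le_of_pow hq1 hroot
    rw [Ideal.absNorm_apply, Submodule.cardQuot_apply] at hnorm
    rw [hnorm] at hle
    nlinarith
  · have : gr (σ ^ 3) x = τ • x := by
      apply RingOfIntegers.ext
      rw [hτK, gr_coe, ← h]
      rfl
    rw [this]
    exact hτ' x

lemma Dat.inert (D : Dat σ r w) {𝔭 : Ideal (𝓞 (cubicFixedField σ))} (hp : 𝔭.IsPrime) (h0 : 𝔭 ≠ ⊥)
    (hP : (Ideal.map (algebraMap (𝓞 (cubicFixedField σ)) (𝓞 K)) 𝔭).IsPrime)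
    (hq : (Nat.card (𝓞 (cubicFixedField σ) ⧸ 𝔭) : ZMod 19) ≠ 0) :
    quadraticChar (ZMod 19) (Nat.card (𝓞 (cubicFixedField σ) ⧸ 𝔭) : ZMod 19) = -1 := by
  have hm : 𝔭.IsMaximal := hp.isMaximal h0
  have hfin' : Finite (𝓞 (cubicFixedField σ) ⧸ 𝔭) := Ideal.finiteQuotientOfFreeOfNeBot 𝔭 h0
  have := Fintype.ofFinite (𝓞 (cubicFixedField σ) ⧸ 𝔭)
  let _ := Ideal.Quotient.field 𝔭
  obtain ⟨p, hchar, f, hpp, hpf⟩ := FiniteField.card' (𝓞 (cubicFixedField σ) ⧸ 𝔭)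
  have hfr := D.frob hp h0 hP w
  rw [← Nat.card_eq_fintype_card] at hpf
  rw [hpf] at hfr hq ⊢
  set P := Ideal.map (algebraMap (𝓞 (cubicFixedField σ)) (𝓞 K)) 𝔭 with hPdef
  have hch : CharP (𝓞 K ⧸ P) p := by
    refine (CharP.charP_iff_prime_eq_zero hpp).mpr ?_
    have h1 : ((p : ℕ) : 𝓞 (cubicFixedField σ) ⧸ 𝔭) = 0 := by
      have h2 : ((p ^ (f : ℕ) : ℕ) : 𝓞 (cubicFixedField σ) ⧸ 𝔭) = 0 := by
        rw [← hpf, Nat.card_eq_fintype_card]; exact FiniteField.cast_card_eq_zero _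
      push_cast at h2
      exact pow_eq_zero_iff (f.ne_zero) |>.mp h2
    have h3 : ((p : ℕ) : 𝓞 (cubicFixedField σ)) ∈ 𝔭 := by
      rw [← Ideal.Quotient.eq_zero_iff_mem, map_natCast]; exact h1
    have h4 := Ideal.mem_map_of_mem (algebraMap (𝓞 (cubicFixedField σ)) (𝓞 K)) h3
    rw [map_natCast, ← hPdef, ← Ideal.Quotient.eq_zero_iff_mem, map_natCast] at h4
    exact h4
  apply inert_char (k := 𝓞 K ⧸ P) hpp (W := Ideal.Quotient.mk P w)
  · have := congrArg (Ideal.Quotient.mk P) D.hw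
    rwa [map_add, map_sub, map_pow, map_zero, map_ofNat] at this
  · rw [D.hw3, ← Ideal.Quotient.eq_zero_iff_mem, map_sub, map_pow, map_sub, map_one] at hfr
    exact (sub_eq_zero.mp hfr).symm
  · rintro rfl
    apply hq
    push_cast
    have : (19 : ZMod 19) = 0 := by decide
    rw [this, zero_pow f.ne_zero]

end Stmt6

namespace Stmt6
variable {K : Type*} [Field K] [NumberField K] {σ : K ≃ₐ[ℚ] K} {r : 𝓞 K →+* ZMod 19} {w : 𝓞 K}

lemma r_ne {s : 𝓞 K} (h : IsCoprime (Ideal.span {s}) (RingHom.ker r)) : r s ≠ 0 := by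
  intro hs
  have hle : Ideal.span {s} ≤ RingHom.ker r := (Ideal.span_singleton_le_iff_mem _).mpr hs
  rw [Ideal.isCoprime_iff_sup_eq, sup_eq_right.mpr hle] at h
  exact RingHom.ker_ne_top r h

lemma Dat.psi0_prod (D : Dat σ r w) {s : 𝓞 K} (hs : r s ≠ 0) :
    psi0 σ r s * gr (σ ^ 3) (psi0 σ r s) = (Ideal.absNorm (Ideal.span {s}) : 𝓞 K) := by
  have e1 : gr (σ ^ 3) (gr (σ ^ 4) s) = gr σ s := by
    rw [← gr_mul, ← pow_add, pow_succ' σ 6, D.six, mul_one]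
  have e2 : gr (σ ^ 3) (gr (σ ^ 5) s) = gr (σ ^ 2) s := by
    rw [← gr_mul, ← pow_add, show 3 + 5 = 2 + 6 from rfl, pow_add σ 2 6, D.six, mul_one]
  have hsq : ((quadraticChar (ZMod 19) (r s) : ℤ) : 𝓞 K) ^ 2 = 1 := by
    exact_mod_cast congrArg (Int.cast : ℤ → 𝓞 K) (quadraticChar_sq_one hs)
  rw [← D.prod s, psi0]
  simp only [map_mul, map_intCast, e1, e2]
  linear_combination (s * gr σ s * gr (σ ^ 2) s * (gr (σ ^ 3) s * gr (σ ^ 4) s * gr (σ ^ 5) s)) * hsq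

lemma Dat.psi0_conj (D : Dat σ r w) (s : 𝓞 K) : psi0 σ r (gr σ s) = gr σ (psi0 σ r s) := by
  have e1 : gr (σ ^ 4) (gr σ s) = gr σ (gr (σ ^ 4) s) := by
    rw [← gr_mul, ← gr_mul, ← pow_succ, ← pow_succ']
  have e2 : gr (σ ^ 5) (gr σ s) = gr σ (gr (σ ^ 5) s) := by
    rw [← gr_mul, ← gr_mul, ← pow_succ, ← pow_succ']
  simp only [psi0, map_mul, map_intCast, e1, e2, D.red]

lemma Dat.psi0_conj3 (D : Dat σ r w) (s : 𝓞 K) : psi0 σ r (gr (σ ^ 3) s) = gr (σ ^ 3) (psi0 σ r s) := by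
  have e3 : ∀ x, gr (σ ^ 3) x = gr σ (gr σ (gr σ x)) := fun x => by
    rw [← gr_mul, ← gr_mul, ← pow_two, ← pow_succ]
  rw [e3, e3, D.psi0_conj, D.psi0_conj, D.psi0_conj]

lemma Dat.case_split (D : Dat σ r w) {𝔭 : Ideal (𝓞 (cubicFixedField σ))} (hp : 𝔭.IsPrime) (h0 : 𝔭 ≠ ⊥)
    {s : 𝓞 K} (hs : r s ≠ 0)
    (hI : Ideal.map (algebraMap (𝓞 (cubicFixedField σ)) (𝓞 K)) 𝔭 = Ideal.span {s})
    {Q₁ Q₂ : Ideal (𝓞 K)} (h1 : Q₁.IsPrime) (h2 : Q₂.IsPrime) (hne : Q₁ ≠ Q₂)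
    (hQ : Ideal.map (algebraMap (𝓞 (cubicFixedField σ)) (𝓞 K)) 𝔭 = Q₁ * Q₂) :
    psi0 σ r s = (Nat.card (𝓞 (cubicFixedField σ) ⧸ 𝔭) : 𝓞 K) := by
  have := D.prin
  have hnorm := D.normF 𝔭
  set I := Ideal.map (algebraMap (𝓞 (cubicFixedField σ)) (𝓞 K)) 𝔭 with hIdef
  have hI0 : I ≠ ⊥ := by
    rw [hIdef, ne_eq, Ideal.map_eq_bot_iff_of_injective]
    · exact h0
    · exact FaithfulSMul.algebraMap_injective _ _
  have hQ1 : Q₁ ≠ ⊥ := by rintro rfl; simp at hQ; exact hI0 hQ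
  have hQ2 : Q₂ ≠ ⊥ := by rintro rfl; simp at hQ; exact hI0 hQ
  have hu := under_eq hp h0 h1 (hQ.le.trans Ideal.mul_le_left)
  obtain ⟨π, rfl⟩ : ∃ π, Q₁ = Ideal.span {π} :=
    ⟨_, (Ideal.span_singleton_generator Q₁).symm⟩
  obtain ⟨η, rfl⟩ : ∃ η, Q₂ = Ideal.span {η} :=
    ⟨_, (Ideal.span_singleton_generator Q₂).symm⟩
  have hass : Ideal.span {s} = Ideal.span {π * η} := by
    rw [← hI, hQ, Ideal.span_singleton_mul_span_singleton]
  have hrs : r (π * η) ≠ 0 := by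
    obtain ⟨c, hc⟩ := Ideal.span_singleton_le_span_singleton.mp hass.le
    intro h
    rw [hc, map_mul, h, zero_mul] at hs
    exact hs rfl
  have hrπ : r π ≠ 0 := fun h => hrs (by rw [map_mul, h, zero_mul])
  have hmemI : gr (σ ^ 3) (π * η) ∈ I := by
    apply invF
    rw [← hIdef, hI, hass]
    exact Ideal.mem_span_singleton_self _
  -- conjugate of the second prime lies over the first
  have hmem1 : gr (σ ^ 3) π * gr (σ ^ 3) η ∈ Ideal.span {π} := by
    rw [← map_mul]
    exact (hQ.le.trans Ideal.mul_le_left) hmemI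
  have h33 : ∀ x, gr (σ ^ 3) (gr (σ ^ 3) x) = x := fun x => by
    rw [← gr_mul, ← pow_add, D.six, gr_one]
  rcases h1.mem_or_mem hmem1 with h | h
  · exfalso
    obtain ⟨u, hu'⟩ := Ideal.mem_span_singleton'.mp h
    have hfix := D.assoc hrπ hu'.symm
    obtain ⟨y, hy⟩ := fixF' hfix
    have hy𝔭 : y ∈ 𝔭 := by
      rw [← hu]
      rw [Ideal.under, Ideal.mem_comap, hy]
      exact Ideal.mem_span_singleton_self _
    have : π ∈ I := by
      rw [← hy]; exact Ideal.mem_map_of_mem _ hy𝔭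
    have h5 : Ideal.span {π} ≤ Ideal.span {η} :=
      (Ideal.span_singleton_le_iff_mem _).mpr ((hQ.le.trans Ideal.mul_le_right) this)
    exact hne ((h1.isMaximal hQ1).eq_of_le h2.ne_top h5)
  · have h5 : Ideal.span {η} ≤ Ideal.span {gr (σ ^ 3) π} := by
      obtain ⟨u, hu'⟩ := Ideal.mem_span_singleton'.mp h
      rw [Ideal.span_singleton_le_span_singleton]
      refine ⟨gr (σ ^ 3) u, ?_⟩
      rw [← h33 η, ← hu', map_mul, mul_comm]
    have h6 : Ideal.span {η} = Ideal.span {gr (σ ^ 3) π} := by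
      refine (h2.isMaximal hQ2).eq_of_le ?_ h5
      rw [ne_eq, Ideal.span_singleton_eq_top]
      intro hun
      have := hun.map (gr (σ ^ 3))
      rw [h33] at this
      exact h1.ne_top (Ideal.span_singleton_eq_top.mpr this)
    rw [D.psi0_congr hass, psi0_mul, D.psi0_congr h6, D.psi0_conj3, D.psi0_prod hrπ]
    have h7 : Ideal.absNorm (Ideal.span {gr (σ ^ 3) π}) = Ideal.absNorm (Ideal.span {π}) := by
      rw [Ideal.absNorm_span_singleton, Ideal.absNorm_span_singleton]
      congr 1
      exact Algebra.norm_eq_of_algEquiv (gr (σ ^ 3)) π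
    rw [hQ, map_mul, h6, h7, ← pow_two] at hnorm
    have := Nat.pow_left_injective (n := 2) (by norm_num) hnorm
    rw [this]

lemma Dat.case_inert (D : Dat σ r w) {𝔭 : Ideal (𝓞 (cubicFixedField σ))} (hp : 𝔭.IsPrime) (h0 : 𝔭 ≠ ⊥)
    {s : 𝓞 K} (hs : r s ≠ 0)
    (hI : Ideal.map (algebraMap (𝓞 (cubicFixedField σ)) (𝓞 K)) 𝔭 = Ideal.span {s})
    (hP : (Ideal.map (algebraMap (𝓞 (cubicFixedField σ)) (𝓞 K)) 𝔭).IsPrime) :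
    psi0 σ r s = -(Nat.card (𝓞 (cubicFixedField σ) ⧸ 𝔭) : 𝓞 K) := by
  have hnorm := D.normF 𝔭
  have hin := D.inert hp h0 hP
  have hmem : gr (σ ^ 3) s ∈ Ideal.span {s} := by
    rw [← hI]
    apply invF
    rw [hI]
    exact Ideal.mem_span_singleton_self _
  obtain ⟨u, hu'⟩ := Ideal.mem_span_singleton'.mp hmem
  have hfix := D.assoc hs hu'.symm
  obtain ⟨n, h1, h2, h3⟩ := D.real hfix
  rw [← hI, hnorm] at h2
  have hψ : psi0 σ r s = ((quadraticChar (ZMod 19) n * n : ℤ) : 𝓞 K) := by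
    rw [psi0, h1, qc_cube hs, h3]
    push_cast
    rfl
  set q := Nat.card (𝓞 (cubicFixedField σ) ⧸ 𝔭) with hq
  have hn0 : (n : ZMod 19) ≠ 0 := by
    rw [← h3]; exact pow_ne_zero _ hs
  have hnq : n = q ∨ n = -q := by
    apply sq_eq_sq_iff_eq_or_eq_neg.mp
    rw [h2]; push_cast; rfl
  have hq0 : (q : ZMod 19) ≠ 0 := by
    rcases hnq with h | h <;> rw [h] at hn0 <;> simpa using hn0
  have hin := hin hq0
  rw [hψ]
  rcases hnq with h | h
  · rw [h]; push_cast; rw [hin]; push_cast; ring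
  · have hm : quadraticChar (ZMod 19) (-1) = -1 := by decide
    rw [h]; push_cast
    rw [← neg_one_mul (q : ZMod 19), map_mul, hin, hm]; push_cast; ring

theorem Dat.main (D : Dat σ r w) : ∃ ψ : Ideal (𝓞 K) → K, IsShimuraIdealChar σ (RingHom.ker r) ψ := by
  have hprin := D.prin
  let ψ : Ideal (𝓞 K) → K := fun I => ((psi0 σ r (Submodule.IsPrincipal.generator I) : 𝓞 K) : K)
  have hψ : ∀ s : 𝓞 K, ψ (Ideal.span {s}) = ((psi0 σ r s : 𝓞 K) : K) := by
    intro s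
    show ((psi0 σ r (Submodule.IsPrincipal.generator (Ideal.span {s})) : 𝓞 K) : K) = _
    rw [D.psi0_congr (Ideal.span_singleton_generator (Ideal.span {s}))]
  have hg : ∀ I : Ideal (𝓞 K), ∃ s, I = Ideal.span {s} := fun I =>
    ⟨_, (Ideal.span_singleton_generator I).symm⟩
  have hsq : ∀ s : 𝓞 K, r s ≠ 0 → ((quadraticChar (ZMod 19) (r s) : ℤ) : 𝓞 K) ^ 2 = 1 := by
    intro s hs
    exact_mod_cast congrArg (Int.cast : ℤ → 𝓞 K) (quadraticChar_sq_one hs)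
  refine ⟨ψ, ?_, ?_, ?_, ?_, ?_, ?_⟩
  · intro I hI hc
    obtain ⟨s, rfl⟩ := hg I
    have hs := r_ne hc
    have hs0 : s ≠ 0 := by rintro rfl; simp at hs
    rw [hψ]
    have h1 := D.psi0_prod hs
    intro h
    have h' : psi0 σ r s = 0 := by
      apply RingOfIntegers.ext; rw [h]; simp
    rw [h', zero_mul] at h1
    have h2 : Ideal.absNorm (Ideal.span {s}) = 0 := by exact_mod_cast h1.symm
    rw [Ideal.absNorm_eq_zero_iff] at h2
    exact hI h2
  · intro I J _ _ _ _
    obtain ⟨s, rfl⟩ := hg I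
    obtain ⟨t, rfl⟩ := hg J
    rw [Ideal.span_singleton_mul_span_singleton, hψ, hψ, hψ, psi0_mul]
    exact map_mul (algebraMap (𝓞 K) K) _ _
  · intro s hc h1
    have h2 : r s = 1 := by
      have : r (s - 1) = 0 := h1
      rw [map_sub, map_one] at this
      exact sub_eq_zero.mp this
    rw [hψ, psi0, h2, map_one, Int.cast_one, one_mul, ← gr_coe, ← gr_coe]
    simp only [map_mul]
  · intro 𝔭 hp h0 hc
    obtain ⟨s, hs⟩ := hg (Ideal.map (algebraMap (𝓞 (cubicFixedField σ)) (𝓞 K)) 𝔭)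
    have hrs : r s ≠ 0 := r_ne (by rw [← hs]; exact hc)
    have hv : ψ (Ideal.map (algebraMap (𝓞 (cubicFixedField σ)) (𝓞 K)) 𝔭) = ((psi0 σ r s : 𝓞 K) : K) := by
      rw [hs, hψ]
    rw [hv]
    constructor
    · rintro ⟨Q₁, Q₂, h1, h2, hne, hQ⟩
      rw [D.case_split hp h0 hrs hs h1 h2 hne hQ]
      exact map_natCast (algebraMap (𝓞 K) K) _
    · intro hP
      rw [D.case_inert hp h0 hrs hs hP]
      have := map_natCast (algebraMap (𝓞 K) K) (Nat.card (𝓞 (cubicFixedField σ) ⧸ 𝔭))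
      rw [← this]
      exact map_neg (algebraMap (𝓞 K) K) _
  · intro I hI hc
    obtain ⟨s, rfl⟩ := hg I
    have hs := r_ne hc
    constructor
    · have h1 := congrArg (algebraMap (𝓞 K) K) (D.psi0_prod hs)
      rw [hψ, ← gr_coe]
      rw [map_mul, map_natCast, Ideal.absNorm_apply, Submodule.cardQuot_apply] at h1
      exact h1
    · rw [hψ, conj_span, conj_span, Ideal.span_singleton_mul_span_singleton,
        Ideal.span_singleton_mul_span_singleton, FractionalIdeal.coeIdeal_span_singleton]
      have h1 : Ideal.span {psi0 σ r s} = Ideal.span {s * gr (σ ^ 4) s * gr (σ ^ 5) s} := by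
        rw [psi0]
        apply Ideal.span_singleton_mul_left_unit
        exact IsUnit.of_mul_eq_one _ ((pow_two _).symm.trans (hsq s hs))
      rw [← FractionalIdeal.coeIdeal_span_singleton, ← FractionalIdeal.coeIdeal_span_singleton, h1]
  · intro I hI hc
    obtain ⟨s, rfl⟩ := hg I
    rw [conj_span, hψ, hψ, D.psi0_conj, gr_coe]

end Stmt6

namespace Stmt6
variable {K : Type*} [Field K] [NumberField K]

lemma exists_red {t : 𝓞 K} (h19 : Ideal.absNorm (Ideal.span {t}) = 19)
    (ht : t ^ 6 + 19 * t ^ 4 + 38 * t ^ 2 + 19 = 0) :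
    ∃ r : 𝓞 K →+* ZMod 19, RingHom.ker r = Ideal.span {t} ∧ ∀ (τ : K ≃ₐ[ℚ] K) x, r (gr τ x) = r x := by
  have h0 : Ideal.span {t} ≠ ⊥ := by
    intro h; rw [h, Ideal.absNorm_bot] at h19; norm_num at h19
  have hfin : Finite (𝓞 K ⧸ Ideal.span {t}) := Ideal.finiteQuotientOfFreeOfNeBot _ h0
  have := Fintype.ofFinite (𝓞 K ⧸ Ideal.span {t})
  have hc : Fintype.card (𝓞 K ⧸ Ideal.span {t}) = 19 := by
    rw [← Nat.card_eq_fintype_card, ← h19, Ideal.absNorm_apply, Submodule.cardQuot_apply]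
  let e := ZMod.ringEquivOfPrime (𝓞 K ⧸ Ideal.span {t}) (by norm_num) hc
  let r : 𝓞 K →+* ZMod 19 := (e.symm : _ →+* ZMod 19).comp (Ideal.Quotient.mk (Ideal.span {t}))
  have hk : RingHom.ker r = Ideal.span {t} := by
    ext x
    rw [RingHom.mem_ker, ← Ideal.Quotient.eq_zero_iff_mem]
    show e.symm _ = 0 ↔ _
    exact map_eq_zero_iff e.symm e.symm.injective
  refine ⟨r, hk, ?_⟩
  intro τ x
  have e19 : (19 : ZMod 19) = 0 := by decide
  have e38 : (38 : ZMod 19) = 0 := by decide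
  have h1 : r (gr τ t) = 0 := by
    have h := congrArg (fun y => r (gr τ y)) ht
    simp only [map_add, map_mul, map_pow, map_ofNat, map_zero, e19, e38, zero_mul, add_zero] at h
    exact pow_eq_zero_iff (by norm_num) |>.mp h
  have h2 : x - ((r x).val : 𝓞 K) ∈ RingHom.ker r := by
    rw [RingHom.mem_ker, map_sub, map_natCast, ZMod.natCast_zmod_val, sub_self]
  rw [hk, Ideal.mem_span_singleton'] at h2
  obtain ⟨y, hy⟩ := h2
  have h3 : x = y * t + ((r x).val : 𝓞 K) := by rw [hy]; ring
  have h4 := congrArg (fun z => r (gr τ z)) h3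
  simp only [map_add, map_mul, h1, mul_zero, zero_add, map_natCast, ZMod.natCast_zmod_val] at h4
  exact h4

lemma conj_eq [IsGalois ℚ K] {σ : K ≃ₐ[ℚ] K} (gen : ∀ τ : K ≃ₐ[ℚ] K, τ ∈ Subgroup.zpowers σ)
    (ord : orderOf σ = 6) {b : K} (hb : b ^ 2 = -19) (φ : K →+* ℂ) (x : K) :
    φ ((σ ^ 3) x) = starRingEnd ℂ (φ x) := by
  obtain ⟨τ, hτ⟩ : ∃ τ : K ≃ₐ[ℚ] K, ∀ x, φ (τ x) = starRingEnd ℂ (φ x) := by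
    obtain ⟨τ, hτ⟩ := ComplexEmbedding.exists_comp_symm_eq_of_comp_eq (k := ℚ) φ
      ((starRingEnd ℂ).comp φ) (Subsingleton.elim _ _)
    exact ⟨τ.symm, fun x => RingHom.congr_fun hτ x⟩
  have hτ2 : τ ^ 2 = 1 := by
    ext y
    apply φ.injective
    rw [pow_two, AlgEquiv.mul_apply, hτ, hτ, Complex.conj_conj]; rfl
  have hτ1 : τ ≠ 1 := by
    rintro rfl
    have h1 := hτ b
    rw [AlgEquiv.one_apply, eq_comm, Complex.conj_eq_iff_real] at h1
    obtain ⟨c, hc⟩ := h1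
    have h2 := congrArg φ hb
    rw [map_pow, hc, map_neg, map_ofNat] at h2
    have h3 : c ^ 2 = -19 := by exact_mod_cast h2
    nlinarith
  have : τ = σ ^ 3 := by
    obtain ⟨k, rfl⟩ := (mem_powers_iff_mem_zpowers (x := σ)).mpr (gen τ)
    simp only at hτ2 hτ1 ⊢
    rw [← pow_mul, ← orderOf_dvd_iff_pow_eq_one, ord] at hτ2
    rw [ne_eq, ← orderOf_dvd_iff_pow_eq_one, ord] at hτ1
    rw [pow_inj_mod, ord]
    omega
  rw [← this, hτ]

theorem exists_dat [IsGalois ℚ K] (hdeg : Module.finrank ℚ K = 6) {a l : 𝓞 K}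
    (ha : a ^ 3 + a ^ 2 - 6 * a - 7 = 0)
    (hl : l ^ 2 = a * l - (a ^ 2 - a - 2))
    {σ : K ≃ₐ[ℚ] K} (gen : ∀ τ : K ≃ₐ[ℚ] K, τ ∈ Subgroup.zpowers σ) :
    ∃ (r : 𝓞 K →+* ZMod 19) (w : 𝓞 K), Dat σ r w ∧ RingHom.ker r = Ideal.span {2 * l - a} := by
  have ord : orderOf σ = 6 := by
    rw [orderOf_eq_card_of_forall_mem_zpowers gen, IsGalois.card_aut_eq_finrank, hdeg]
  have ht := rel_t ha hl
  push_cast at ht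
  obtain ⟨r, hk, hr⟩ := exists_red (norm_t hdeg ha hl) (by linear_combination ht)
  have hw := rel_w ha hl
  generalize 4 + a + 4 * l - a * l - a ^ 2 * l = w at hw
  have hb : (2 * (w : K) - 1) ^ 2 = -19 := by
    have h := congrArg (algebraMap (𝓞 K) K) hw
    rw [map_add, map_sub, map_pow, map_ofNat (algebraMap (𝓞 K) K) 5, map_zero] at h
    linear_combination 4 * h
  have hc := conj_eq gen ord hb
  refine ⟨r, w, ⟨hdeg, inferInstance, gen, ord, hc, hr σ, hw, ?_, pid hdeg ha hl⟩, hk⟩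
  have h1 := congrArg (gr (σ ^ 3)) hw
  rw [map_add, map_sub, map_pow, map_ofNat (gr (σ ^ 3)) 5, map_zero] at h1
  have h2 : (gr (σ ^ 3) w - w) * (gr (σ ^ 3) w - (1 - w)) = 0 := by linear_combination h1 - hw
  rcases mul_eq_zero.mp h2 with h | h
  · exfalso
    obtain ⟨φ⟩ : Nonempty (K →+* ℂ) := inferInstance
    have h3 := hc φ w
    rw [← gr_coe, sub_eq_zero.mp h, eq_comm, Complex.conj_eq_iff_real] at h3
    obtain ⟨c, hc'⟩ := h3
    have h4 := congrArg φ hb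
    rw [map_pow, map_sub, map_mul, hc', map_neg, map_ofNat, map_ofNat, map_one] at h4
    have h5 : (2 * c - 1) ^ 2 = -19 := by exact_mod_cast h4
    nlinarith
  · exact sub_eq_zero.mp h

end Stmt6

/-- For the sextic cyclic CM field ℚ(α, √-19) of conductor 19 there exists a Shimura ideal character. -/
theorem stmt_6 (K : Type*) [Field K] [NumberField K]
    (hdeg : Module.finrank ℚ K = 6) [IsGalois ℚ K] (hcyc : IsCyclic (K ≃ₐ[ℚ] K))
    (α β : K) (hα : α ^ 3 = 57 * α - 133) (hβ : β ^ 2 = (-19 : K)) :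
    ∃ (σ : K ≃ₐ[ℚ] K) (𝔠 : Ideal (𝓞 K)) (ψ : Ideal (𝓞 K) → K),
      (∀ τ : K ≃ₐ[ℚ] K, τ ∈ Subgroup.zpowers σ) ∧ 𝔠 ≠ ⊥ ∧
      IsShimuraIdealChar σ 𝔠 ψ := by
  obtain ⟨a, l, ha, hl⟩ := Stmt6.exists_al α β hα hβ
  obtain ⟨σ, gen⟩ := hcyc.exists_generator
  obtain ⟨r, w, D, hk⟩ := Stmt6.exists_dat hdeg ha hl gen
  obtain ⟨ψ, hψ⟩ := D.main
  refine ⟨σ, RingHom.ker r, ψ, gen, ?_, hψ⟩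
  rw [hk]
  intro h
  have h19 := Stmt6.norm_t hdeg ha hl
  rw [h, Ideal.absNorm_bot] at h19
  norm_num at h19
end
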